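/- arXiv:2511.12198 — 4 statements merged into one kernel-verified Lean document; each statement's English description precedes it below -/
import Mathlib

section
/- Let Λ be a finite-dimensional algebra over a field K and let F be a torsion-free class in mod Λ. Then the map M ↦ Filt(F ∪ {M}) is a bijection from the set MCE(F) of isomorphism classes of minimal co-extending modules for F to the set of torsion-free classes F' in mod Λ that cover F. -/
open Function DirectSum

namespace BrickPaper

variable (Λ : Type) [Ring Λ]

/-- `M` belongs to `mod Λ`, i.e. is a finitely generated module. -/
abbrev FG (M : ModuleCat.{0} Λ) : Prop := Module.Finite Λ M

/-- A class of modules closed under isomorphism. -/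
def IsoClosed (C : Set (ModuleCat.{0} Λ)) : Prop :=
  ∀ ⦃M N : ModuleCat.{0} Λ⦄, Nonempty (M ≃ₗ[Λ] N) → M ∈ C → N ∈ C

/-- A class of modules containing the zero modules. -/
def HasZeroObj (C : Set (ModuleCat.{0} Λ)) : Prop :=
  ∀ M : ModuleCat.{0} Λ, Subsingleton M → M ∈ C

/-- Closure under extensions: if `0 → A → M → B → 0` is exact with `A, B ∈ C` then `M ∈ C`. -/
def ExtClosed (C : Set (ModuleCat.{0} Λ)) : Prop :=
  ∀ ⦃A M B : ModuleCat.{0} Λ⦄ (f : A →ₗ[Λ] M) (g : M →ₗ[Λ] B),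
    Function.Injective f → Function.Surjective g →
    LinearMap.range f = LinearMap.ker g → A ∈ C → B ∈ C → M ∈ C

/-- Closure under quotients (images of surjections). -/
def QuotClosed (C : Set (ModuleCat.{0} Λ)) : Prop :=
  ∀ ⦃M N : ModuleCat.{0} Λ⦄ (g : M →ₗ[Λ] N), Function.Surjective g → M ∈ C → N ∈ C

/-- Closure under submodules (sources of injections). -/
def SubClosed (C : Set (ModuleCat.{0} Λ)) : Prop :=
  ∀ ⦃M N : ModuleCat.{0} Λ⦄ (f : M →ₗ[Λ] N), Function.Injective f → N ∈ C → M ∈ C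

/-- Closure under kernels of morphisms between members. -/
def KerClosed (C : Set (ModuleCat.{0} Λ)) : Prop :=
  ∀ ⦃M N : ModuleCat.{0} Λ⦄ (f : M →ₗ[Λ] N), M ∈ C → N ∈ C →
    ModuleCat.of Λ ↥(LinearMap.ker f) ∈ C

/-- Closure under cokernels of morphisms between members. -/
def CokerClosed (C : Set (ModuleCat.{0} Λ)) : Prop :=
  ∀ ⦃M N : ModuleCat.{0} Λ⦄ (f : M →ₗ[Λ] N), M ∈ C → N ∈ C →
    ModuleCat.of Λ ((N : Type) ⧸ LinearMap.range f) ∈ C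

/-- A wide subcategory of `mod Λ`: a class of finitely generated modules, closed under
isomorphisms, containing `0`, and closed under kernels, cokernels and extensions. -/
def IsWide (C : Set (ModuleCat.{0} Λ)) : Prop :=
  (∀ M ∈ C, FG Λ M) ∧ IsoClosed Λ C ∧ HasZeroObj Λ C ∧
    KerClosed Λ C ∧ CokerClosed Λ C ∧ ExtClosed Λ C

/-- A wide subcategory of the big module category `Mod Λ` (no finiteness condition). -/
def IsWideBig (C : Set (ModuleCat.{0} Λ)) : Prop :=
  IsoClosed Λ C ∧ HasZeroObj Λ C ∧ KerClosed Λ C ∧ CokerClosed Λ C ∧ ExtClosed Λ C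

/-- A torsion class in `mod Λ`: closed under quotients and extensions. -/
def IsTorsionClass (C : Set (ModuleCat.{0} Λ)) : Prop :=
  (∀ M ∈ C, FG Λ M) ∧ IsoClosed Λ C ∧ HasZeroObj Λ C ∧ QuotClosed Λ C ∧ ExtClosed Λ C

/-- A torsion-free class in `mod Λ`: closed under submodules and extensions. -/
def IsTorsionFreeClass (C : Set (ModuleCat.{0} Λ)) : Prop :=
  (∀ M ∈ C, FG Λ M) ∧ IsoClosed Λ C ∧ HasZeroObj Λ C ∧ SubClosed Λ C ∧ ExtClosed Λ C

/-- The smallest torsion class containing `X`. -/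
def torsClosure (X : Set (ModuleCat.{0} Λ)) : Set (ModuleCat.{0} Λ) :=
  ⋂₀ {C | IsTorsionClass Λ C ∧ X ⊆ C}

/-- The smallest torsion-free class containing `X`. -/
def torfClosure (X : Set (ModuleCat.{0} Λ)) : Set (ModuleCat.{0} Λ) :=
  ⋂₀ {C | IsTorsionFreeClass Λ C ∧ X ⊆ C}

/-- A widely generated torsion class. -/
def IsWidelyGenTors (T : Set (ModuleCat.{0} Λ)) : Prop :=
  IsTorsionClass Λ T ∧ ∃ W, IsWide Λ W ∧ T = torsClosure Λ W

/-- A widely generated torsion-free class. -/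
def IsWidelyGenTorf (F : Set (ModuleCat.{0} Λ)) : Prop :=
  IsTorsionFreeClass Λ F ∧ ∃ W, IsWide Λ W ∧ F = torfClosure Λ W

/-- A finitely generated torsion class: generated by a single module of `mod Λ`. -/
def IsFinGenTors (T : Set (ModuleCat.{0} Λ)) : Prop :=
  IsTorsionClass Λ T ∧ ∃ M : ModuleCat.{0} Λ, FG Λ M ∧ T = torsClosure Λ {M}

/-- `T' ` covers `T` in the poset of torsion classes. -/
def TorsCovers (T' T : Set (ModuleCat.{0} Λ)) : Prop :=
  IsTorsionClass Λ T' ∧ T ⊂ T' ∧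
    ∀ T'', IsTorsionClass Λ T'' → T ⊂ T'' → T'' ⊆ T' → T'' = T'

/-- `F'` covers `F` in the poset of torsion-free classes. -/
def TorfCovers (F' F : Set (ModuleCat.{0} Λ)) : Prop :=
  IsTorsionFreeClass Λ F' ∧ F ⊂ F' ∧
    ∀ F'', IsTorsionFreeClass Λ F'' → F ⊂ F'' → F'' ⊆ F' → F'' = F'

/-- A brick: a finitely generated module whose endomorphism ring is a division ring. -/
def IsBrick (M : ModuleCat.{0} Λ) : Prop :=
  FG Λ M ∧ Nontrivial M ∧ ∀ f : M →ₗ[Λ] M, f ≠ 0 → Function.Bijective f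

/-- A semibrick, regarded as an isomorphism-closed class of bricks (i.e. a set of
isomorphism classes of bricks) which are pairwise Hom-orthogonal. -/
def IsSemibrick (S : Set (ModuleCat.{0} Λ)) : Prop :=
  (∀ M ∈ S, IsBrick Λ M) ∧ IsoClosed Λ S ∧
    ∀ M ∈ S, ∀ N ∈ S, IsEmpty (M ≃ₗ[Λ] N) → ∀ f : M →ₗ[Λ] N, f = 0

/-- A monobrick, regarded as an isomorphism-closed class of bricks (i.e. a set of
isomorphism classes of bricks) such that every morphism between members is zero or injective. -/
def IsMonobrick (S : Set (ModuleCat.{0} Λ)) : Prop :=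
  (∀ M ∈ S, IsBrick Λ M) ∧ IsoClosed Λ S ∧
    ∀ M ∈ S, ∀ N ∈ S, ∀ f : M →ₗ[Λ] N, f = 0 ∨ Function.Injective f

/-- `N` is a cofinal extension of the monobrick `M`. -/
def IsCofinalExtension (M N : Set (ModuleCat.{0} Λ)) : Prop :=
  IsMonobrick Λ N ∧ M ⊆ N ∧
    ∀ X ∈ N, ∃ Y ∈ M, ∃ f : X →ₗ[Λ] Y, Function.Injective f

/-- A cofinally closed monobrick: a monobrick with no proper cofinal extension. -/
def IsCofinallyClosed (M : Set (ModuleCat.{0} Λ)) : Prop :=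
  IsMonobrick Λ M ∧ ∀ N, IsCofinalExtension Λ M N → N = M

/-- `S` contains only finitely many modules up to isomorphism. -/
def FiniteUpToIso (S : Set (ModuleCat.{0} Λ)) : Prop :=
  ∃ B : Set (ModuleCat.{0} Λ), B.Finite ∧ ∀ M ∈ S, ∃ N ∈ B, Nonempty (M ≃ₗ[Λ] N)

/-- `Λ` is brick-finite: there are only finitely many bricks up to isomorphism. -/
def BrickFinite : Prop := FiniteUpToIso Λ {M | IsBrick Λ M}

/-- Right Hom-perpendicular class `T^⊥` inside `mod Λ`. -/
def rPerp (T : Set (ModuleCat.{0} Λ)) : Set (ModuleCat.{0} Λ) :=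
  {M | FG Λ M ∧ ∀ X ∈ T, ∀ f : X →ₗ[Λ] M, f = 0}

/-- Left Hom-perpendicular class `^⊥F` inside `mod Λ`. -/
def lPerp (F : Set (ModuleCat.{0} Λ)) : Set (ModuleCat.{0} Λ) :=
  {M | FG Λ M ∧ ∀ Y ∈ F, ∀ f : M →ₗ[Λ] Y, f = 0}

/-- A minimal extending module for a torsion class `T`. -/
def IsMinExt (T : Set (ModuleCat.{0} Λ)) (M : ModuleCat.{0} Λ) : Prop :=
  FG Λ M ∧ Nontrivial M ∧
    (∀ S : Submodule Λ M, S ≠ ⊥ → ModuleCat.of Λ ((M : Type) ⧸ S) ∈ T) ∧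
    (∀ (X T' : ModuleCat.{0} Λ) (f : M →ₗ[Λ] X) (g : X →ₗ[Λ] T'),
      Function.Injective f → Function.Surjective g →
      LinearMap.range f = LinearMap.ker g → T' ∈ T →
      (¬ ∃ r : X →ₗ[Λ] M, r ∘ₗ f = LinearMap.id) → X ∈ T) ∧
    (∀ X ∈ T, ∀ f : X →ₗ[Λ] M, f = 0)

/-- A minimal co-extending module for a torsion-free class `F`. -/
def IsMinCoext (F : Set (ModuleCat.{0} Λ)) (M : ModuleCat.{0} Λ) : Prop :=
  FG Λ M ∧ Nontrivial M ∧
    (∀ S : Submodule Λ M, S ≠ ⊤ → ModuleCat.of Λ ↥S ∈ F) ∧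
    (∀ (X F' : ModuleCat.{0} Λ) (f : F' →ₗ[Λ] X) (g : X →ₗ[Λ] M),
      Function.Injective f → Function.Surjective g →
      LinearMap.range f = LinearMap.ker g → F' ∈ F →
      (¬ ∃ s : M →ₗ[Λ] X, g ∘ₗ s = LinearMap.id) → X ∈ F) ∧
    (∀ Y ∈ F, ∀ f : M →ₗ[Λ] Y, f = 0)

/-- The set (of representatives of isomorphism classes) of minimal extending modules. -/
def ME (T : Set (ModuleCat.{0} Λ)) : Set (ModuleCat.{0} Λ) := {M | IsMinExt Λ T M}

/-- The set (of representatives of isomorphism classes) of minimal co-extending modules. -/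
def MCE (F : Set (ModuleCat.{0} Λ)) : Set (ModuleCat.{0} Λ) := {M | IsMinCoext Λ F M}

/-- `M` admits a finite filtration with subquotients isomorphic to members of `B`. -/
def FiltMem (B : Set (ModuleCat.{0} Λ)) (M : ModuleCat.{0} Λ) : Prop :=
  ∃ (n : ℕ) (c : Fin (n + 1) → Submodule Λ M), Monotone c ∧ c 0 = ⊥ ∧ c (Fin.last n) = ⊤ ∧
    ∀ i : Fin n, ∃ N ∈ B,
      Nonempty ((↥(c i.succ) ⧸ Submodule.comap (c i.succ).subtype (c i.castSucc)) ≃ₗ[Λ] N)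

/-- `Filt B`. -/
def filtClosure (B : Set (ModuleCat.{0} Λ)) : Set (ModuleCat.{0} Λ) :=
  {M | FiltMem Λ B M}

/-- The simple objects of a subcategory `C`, i.e. nonzero members with no proper nonzero
subobject belonging to `C`. -/
def simOf (C : Set (ModuleCat.{0} Λ)) : Set (ModuleCat.{0} Λ) :=
  {M | M ∈ C ∧ Nontrivial M ∧
    ∀ (X : ModuleCat.{0} Λ) (f : X →ₗ[Λ] M), X ∈ C → Function.Injective f →
      LinearMap.range f = ⊥ ∨ LinearMap.range f = ⊤}

/-- The subcategory `α(T) = {X ∈ T : for all g : Y → X with Y ∈ T, ker g ∈ T}`. -/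
def alphaOf (T : Set (ModuleCat.{0} Λ)) : Set (ModuleCat.{0} Λ) :=
  {X | X ∈ T ∧ ∀ (Y : ModuleCat.{0} Λ) (g : Y →ₗ[Λ] X), Y ∈ T →
    ModuleCat.of Λ ↥(LinearMap.ker g) ∈ T}

/-- Covariantly finite subcategory of `mod Λ`. -/
def CovariantlyFinite (B : Set (ModuleCat.{0} Λ)) : Prop :=
  ∀ M : ModuleCat.{0} Λ, FG Λ M → ∃ N ∈ B, ∃ f : M →ₗ[Λ] N,
    ∀ N' ∈ B, ∀ g : M →ₗ[Λ] N', ∃ h : N →ₗ[Λ] N', h ∘ₗ f = g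

/-- Contravariantly finite subcategory of `mod Λ`. -/
def ContravariantlyFinite (B : Set (ModuleCat.{0} Λ)) : Prop :=
  ∀ M : ModuleCat.{0} Λ, FG Λ M → ∃ N ∈ B, ∃ f : N →ₗ[Λ] M,
    ∀ N' ∈ B, ∀ g : N' →ₗ[Λ] M, ∃ h : N' →ₗ[Λ] N, f ∘ₗ h = g

/-- Functorially finite subcategory of `mod Λ`. -/
def FunctoriallyFinite (B : Set (ModuleCat.{0} Λ)) : Prop :=
  CovariantlyFinite Λ B ∧ ContravariantlyFinite Λ B

/-- Closure under (set-indexed) coproducts. -/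
def CoprodClosed (C : Set (ModuleCat.{0} Λ)) : Prop :=
  ∀ (ι : Type) (M : ι → ModuleCat.{0} Λ), (∀ i, M i ∈ C) →
    ModuleCat.of Λ (⨁ i, (M i : Type)) ∈ C

/-- Closure under (set-indexed) products. -/
def ProdClosed (C : Set (ModuleCat.{0} Λ)) : Prop :=
  ∀ (ι : Type) (M : ι → ModuleCat.{0} Λ), (∀ i, M i ∈ C) →
    ModuleCat.of Λ ((i : ι) → (M i : Type)) ∈ C

/-! Lattice-theoretic notions in the complete lattice of torsion classes. -/

/-- The join of a set of torsion classes. -/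
def torsJoin (X : Set (Set (ModuleCat.{0} Λ))) : Set (ModuleCat.{0} Λ) :=
  torsClosure Λ (⋃₀ X)

/-- The meet of a set of torsion classes (inside the lattice of torsion classes,
whose top element is `mod Λ`). -/
def torsMeet (X : Set (Set (ModuleCat.{0} Λ))) : Set (ModuleCat.{0} Λ) :=
  {M | FG Λ M} ∩ ⋂₀ X

/-- A completely join-irreducible torsion class. -/
def CompletelyJoinIrred (J : Set (ModuleCat.{0} Λ)) : Prop :=
  IsTorsionClass Λ J ∧
    ∀ X : Set (Set (ModuleCat.{0} Λ)), (∀ a ∈ X, IsTorsionClass Λ a) →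
      torsJoin Λ X = J → J ∈ X

/-- `J_* = ⋁ {x : x < J}`. -/
def jstar (J : Set (ModuleCat.{0} Λ)) : Set (ModuleCat.{0} Λ) :=
  torsJoin Λ {C | IsTorsionClass Λ C ∧ C ⊂ J}

/-- `k = κ(J) = max {x : J ∧ x = J_*}`. -/
def IsKappa (J k : Set (ModuleCat.{0} Λ)) : Prop :=
  IsTorsionClass Λ k ∧ J ∩ k = jstar Λ J ∧
    ∀ C, IsTorsionClass Λ C → J ∩ C = jstar Λ J → C ⊆ k

/-- `A` is a join representation of the torsion class `T`. -/
def IsJoinRep (T : Set (ModuleCat.{0} Λ)) (A : Set (Set (ModuleCat.{0} Λ))) : Prop :=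
  (∀ a ∈ A, IsTorsionClass Λ a) ∧ torsJoin Λ A = T

/-- `A` refines `B`. -/
def Refines (A B : Set (Set (ModuleCat.{0} Λ))) : Prop :=
  ∀ a ∈ A, ∃ b ∈ B, a ⊆ b

/-- `A` is the canonical join representation of `T`. -/
def IsCJR (T : Set (ModuleCat.{0} Λ)) (A : Set (Set (ModuleCat.{0} Λ))) : Prop :=
  IsJoinRep Λ T A ∧ (∀ B, IsJoinRep Λ T B → Refines Λ A B) ∧
    ∀ a ∈ A, ∀ b ∈ A, a ⊆ b → a = b

/-- `Kb = κ̄(T) = ⋀ {κ(j) : j ∈ CJR(T)}`, the extended kappa map. -/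
def IsKappaBar (T Kb : Set (ModuleCat.{0} Λ)) : Prop :=
  ∃ A, IsCJR Λ T A ∧ (∀ j ∈ A, CompletelyJoinIrred Λ j) ∧
    (∀ j ∈ A, ∃ k, IsKappa Λ j k) ∧
    Kb = torsMeet Λ {k | ∃ j ∈ A, IsKappa Λ j k}

/-- The kappa order: `a ≤_κ b` iff `a ≤ b` and `κ̄(a) ≥ κ̄(b)`. -/
def KappaLE (a b : Set (ModuleCat.{0} Λ)) : Prop :=
  a ⊆ b ∧ ∀ Ka Kb, IsKappaBar Λ a Ka → IsKappaBar Λ b Kb → Kb ⊆ Ka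

/-- Inductive form of `FiltMem`: modules built from `0` by finitely many extensions whose
cokernels lie in `B`. -/
inductive FiltBuilt (B : Set (ModuleCat.{0} Λ)) : ModuleCat.{0} Λ → Prop
  | zero (M : ModuleCat.{0} Λ) (hM : Subsingleton M) : FiltBuilt B M
  | step (A M N : ModuleCat.{0} Λ) (f : A →ₗ[Λ] M) (g : M →ₗ[Λ] N)
      (hf : Function.Injective f) (hg : Function.Surjective g)
      (hfg : LinearMap.range f = LinearMap.ker g) (hA : FiltBuilt B A) (hN : N ∈ B) :
      FiltBuilt B M

variable {Λ}

namespace FiltBuilt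

variable {B : Set (ModuleCat.{0} Λ)}

theorem of_equiv {M N : ModuleCat.{0} Λ} (h : FiltBuilt Λ B M) (e : M ≃ₗ[Λ] N) :
    FiltBuilt Λ B N := by
  cases h with
  | zero _ hM => exact .zero _ e.symm.injective.subsingleton
  | step A _ P f g hf hg hfg hA hN =>
    refine .step A _ P (e.toLinearMap ∘ₗ f) (g ∘ₗ e.symm.toLinearMap)
      (e.injective.comp hf) (hg.comp e.symm.surjective) ?_ hA hN
    rw [LinearMap.range_comp, LinearMap.ker_comp, hfg, Submodule.map_equiv_eq_comap_symm]

theorem of_mem {M : ModuleCat.{0} Λ} (h : M ∈ B) : FiltBuilt Λ B M :=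
  .step (ModuleCat.of Λ PUnit) M M 0 LinearMap.id (injective_of_subsingleton _)
    Function.surjective_id (by simp) (.zero _ (inferInstanceAs (Subsingleton PUnit))) h

theorem of_filtMem {M : ModuleCat.{0} Λ} (h : FiltMem Λ B M) : FiltBuilt Λ B M := by
  obtain ⟨n, c, hc, h0, hl, hq⟩ := h
  have key : ∀ i : Fin (n + 1), FiltBuilt Λ B (ModuleCat.of Λ ↥(c i)) := by
    intro i
    induction i using Fin.induction with
    | zero => exact .zero _ (by rw [h0]; exact inferInstanceAs (Subsingleton (⊥ : Submodule Λ M)))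
    | succ i ih =>
      obtain ⟨N, hN, ⟨e⟩⟩ := hq i
      have hle : c i.castSucc ≤ c i.succ := hc (Fin.castSucc_lt_succ).le
      refine .step _ (ModuleCat.of Λ ↥(c i.succ)) N (Submodule.inclusion hle)
        (e.toLinearMap ∘ₗ Submodule.mkQ _) (Submodule.inclusion_injective hle)
        (e.surjective.comp (Submodule.mkQ_surjective _)) ?_ ih hN
      rw [LinearEquiv.ker_comp, Submodule.ker_mkQ, Submodule.range_inclusion]
  have h := key (Fin.last n)
  rw [hl] at h
  exact h.of_equiv Submodule.topEquiv

theorem filtMem {M : ModuleCat.{0} Λ} (h : FiltBuilt Λ B M) : FiltMem Λ B M := by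
  induction h with
  | zero M hM =>
    exact ⟨0, fun _ => ⊥, monotone_const, rfl, Subsingleton.elim _ _, fun i => i.elim0⟩
  | step A M N f g hf hg hfg hA hN ih =>
    obtain ⟨n, c, hc, h0, hl, hq⟩ := ih
    refine ⟨n + 1, Fin.snoc (α := fun _ => Submodule Λ M) (fun i => (c i).map f) ⊤,
      ?_, ?_, ?_, ?_⟩
    · rw [Fin.monotone_iff_le_succ]
      intro i
      induction i using Fin.lastCases with
      | last => simp
      | cast i =>
        rw [Fin.snoc_castSucc, Fin.succ_castSucc, Fin.snoc_castSucc]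
        exact Submodule.map_mono (hc (Fin.castSucc_lt_succ).le)
    · rw [← Fin.castSucc_zero, Fin.snoc_castSucc, h0, Submodule.map_bot]
    · simp
    · intro i
      induction i using Fin.lastCases with
      | last =>
        refine ⟨N, hN, ?_⟩
        rw [Fin.succ_last, Fin.snoc_last, Fin.snoc_castSucc, hl, Submodule.map_top, hfg]
        refine ⟨(Submodule.quotEquivOfEq _ _ ?_).trans (LinearMap.quotKerEquivOfSurjective
          (g ∘ₗ (⊤ : Submodule Λ M).subtype) ?_)⟩
        · rw [LinearMap.ker_comp]
        · intro y
          obtain ⟨x, rfl⟩ := hg y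
          exact ⟨⟨x, trivial⟩, rfl⟩
      | cast i =>
        obtain ⟨P, hP, ⟨e⟩⟩ := hq i
        refine ⟨P, hP, ?_⟩
        rw [Fin.snoc_castSucc, Fin.succ_castSucc, Fin.snoc_castSucc]
        refine ⟨(Submodule.Quotient.equiv _ _
          (Submodule.equivMapOfInjective f hf (c i.succ)) ?_).symm.trans e⟩
        ext ⟨y, hy⟩
        obtain ⟨x, hx, rfl⟩ := hy
        constructor
        · rintro ⟨z, hz, hzx⟩
          exact ⟨z, hz, congrArg Subtype.val hzx⟩
        · rintro ⟨z, hz, hzx⟩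
          obtain rfl := hf hzx
          exact ⟨⟨z, hx⟩, hz, rfl⟩

theorem ext {A M N : ModuleCat.{0} Λ} (f : A →ₗ[Λ] M) (g : M →ₗ[Λ] N)
    (hf : Function.Injective f) (hg : Function.Surjective g)
    (hfg : LinearMap.range f = LinearMap.ker g) (hA : FiltBuilt Λ B A) (hN : FiltBuilt Λ B N) :
    FiltBuilt Λ B M := by
  induction hN generalizing M with
  | zero N hN =>
    refine hA.of_equiv (LinearEquiv.ofBijective f ⟨hf, ?_⟩)
    rw [← LinearMap.range_eq_top, hfg, LinearMap.ker_eq_top]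
    exact LinearMap.ext fun _ => Subsingleton.elim _ _
  | step A₁ N N₂ f₁ g₁ hf₁ hg₁ hfg₁ _ hN₂ ih =>
    refine .step (ModuleCat.of Λ ↥(LinearMap.ker (g₁ ∘ₗ g))) M N₂ (Submodule.subtype _)
      (g₁ ∘ₗ g) (Submodule.injective_subtype _) (hg₁.comp hg) (Submodule.range_subtype _) ?_ hN₂
    have hmem : ∀ x : ↥(LinearMap.ker (g₁ ∘ₗ g)),
        (g ∘ₗ Submodule.subtype _) x ∈ LinearMap.range f₁ := by
      intro x
      rw [hfg₁]
      exact x.2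
    have hker : ∀ a : A, f a ∈ LinearMap.ker (g₁ ∘ₗ g) := by
      intro a
      have : g (f a) = 0 := by
        rw [← LinearMap.mem_ker, ← hfg]
        exact ⟨a, rfl⟩
      simp [this]
    refine ih (M := ModuleCat.of Λ ↥(LinearMap.ker (g₁ ∘ₗ g))) (LinearMap.codRestrict _ f hker)
      ((LinearEquiv.ofInjective f₁ hf₁).symm.toLinearMap ∘ₗ
        LinearMap.codRestrict _ (g ∘ₗ Submodule.subtype _) hmem) ?_ ?_ ?_
    · intro a b hab
      exact hf (congrArg Subtype.val hab)
    · refine (LinearEquiv.ofInjective f₁ hf₁).symm.surjective.comp ?_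
      rintro ⟨y, hy⟩
      obtain ⟨x, rfl⟩ := hg y
      exact ⟨⟨x, by rwa [hfg₁] at hy⟩, rfl⟩
    · rw [LinearEquiv.ker_comp, LinearMap.ker_codRestrict, LinearMap.range_codRestrict, hfg]
      rfl

theorem finite (hB : ∀ N ∈ B, FG Λ N) {M : ModuleCat.{0} Λ} (h : FiltBuilt Λ B M) : FG Λ M := by
  induction h with
  | zero M hM => exact Module.Finite.of_finite
  | step A M N f g hf hg hfg _ hN ih =>
    have := hB N hN
    have : Module.Finite Λ A := ih
    have : Module.Finite Λ ↥(LinearMap.ker g) := by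
      rw [← hfg]
      infer_instance
    have : Module.Finite Λ ((M : Type) ⧸ LinearMap.ker g) :=
      Module.Finite.equiv (g.quotKerEquivOfSurjective hg).symm
    exact Module.Finite.of_submodule_quotient (LinearMap.ker g)

theorem mem_of_subset {C : Set (ModuleCat.{0} Λ)} (hC : IsTorsionFreeClass Λ C) (hBC : B ⊆ C)
    {M : ModuleCat.{0} Λ} (h : FiltBuilt Λ B M) : M ∈ C := by
  induction h with
  | zero M hM => exact hC.2.2.1 M hM
  | step A M N f g hf hg hfg _ hN ih => exact hC.2.2.2.2 f g hf hg hfg ih (hBC hN)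

end FiltBuilt

theorem mem_filtClosure_iff {B : Set (ModuleCat.{0} Λ)} {M : ModuleCat.{0} Λ} :
    M ∈ filtClosure Λ B ↔ FiltBuilt Λ B M :=
  ⟨.of_filtMem, fun h => h.filtMem⟩

theorem filtClosure_subset {B C : Set (ModuleCat.{0} Λ)} (hC : IsTorsionFreeClass Λ C)
    (hBC : B ⊆ C) : filtClosure Λ B ⊆ C :=
  fun _ hM => (mem_filtClosure_iff.1 hM).mem_of_subset hC hBC

theorem subset_filtClosure (B : Set (ModuleCat.{0} Λ)) : B ⊆ filtClosure Λ B :=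
  fun _ hM => mem_filtClosure_iff.2 (.of_mem hM)

theorem mem_filtClosure_self (F : Set (ModuleCat.{0} Λ)) (M : ModuleCat.{0} Λ) :
    M ∈ filtClosure Λ (F ∪ {M}) :=
  subset_filtClosure _ (Or.inr rfl)

theorem subset_filtClosure_union (F : Set (ModuleCat.{0} Λ)) (M : ModuleCat.{0} Λ) :
    F ⊆ filtClosure Λ (F ∪ {M}) :=
  Set.subset_union_left.trans (subset_filtClosure _)

section TorsionFree

variable {F : Set (ModuleCat.{0} Λ)}

theorem filtBuilt_of_injective (hF : IsTorsionFreeClass Λ F) {M : ModuleCat.{0} Λ}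
    (hM : ∀ S : Submodule Λ M, S ≠ ⊤ → ModuleCat.of Λ ↥S ∈ F) {N Z : ModuleCat.{0} Λ}
    (ι : N →ₗ[Λ] Z) (hι : Function.Injective ι) (hZ : FiltBuilt Λ (F ∪ {M}) Z) :
    FiltBuilt Λ (F ∪ {M}) N := by
  induction hZ generalizing N with
  | zero Z hZ => exact .zero _ hι.subsingleton
  | step A Z P f g hf hg hfg _ hP ih =>
    have hmem : ∀ x : ↥(LinearMap.ker (g ∘ₗ ι)),
        (ι ∘ₗ Submodule.subtype _) x ∈ LinearMap.range f := by
      intro x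
      rw [hfg]
      exact x.2
    have hK : FiltBuilt Λ (F ∪ {M}) (ModuleCat.of Λ ↥(LinearMap.ker (g ∘ₗ ι))) := by
      refine ih ((LinearEquiv.ofInjective f hf).symm.toLinearMap ∘ₗ
        LinearMap.codRestrict _ (ι ∘ₗ Submodule.subtype _) hmem) ?_
      refine (LinearEquiv.ofInjective f hf).symm.injective.comp ?_
      intro a b hab
      exact Subtype.ext (hι (congrArg Subtype.val hab))
    by_cases htop : LinearMap.range (g ∘ₗ ι) = ⊤
    · exact .step _ N P (Submodule.subtype _) (g ∘ₗ ι) (Submodule.injective_subtype _)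
        (LinearMap.range_eq_top.1 htop) (Submodule.range_subtype _) hK hP
    · refine .step _ N (ModuleCat.of Λ ↥(LinearMap.range (g ∘ₗ ι))) (Submodule.subtype _)
        (g ∘ₗ ι).rangeRestrict (Submodule.injective_subtype _)
        (LinearMap.surjective_rangeRestrict _) ?_ hK (Or.inl ?_)
      · rw [Submodule.range_subtype, LinearMap.ker_rangeRestrict]
      · rcases hP with hP | rfl
        · exact hF.2.2.2.1 (Submodule.subtype _) (Submodule.injective_subtype _) hP
        · exact hM _ htop

theorem isTorsionFreeClass_filtClosure (hF : IsTorsionFreeClass Λ F) {M : ModuleCat.{0} Λ}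
    (hfg : FG Λ M) (hM : ∀ S : Submodule Λ M, S ≠ ⊤ → ModuleCat.of Λ ↥S ∈ F) :
    IsTorsionFreeClass Λ (filtClosure Λ (F ∪ {M})) := by
  simp only [IsTorsionFreeClass, IsoClosed, HasZeroObj, SubClosed, ExtClosed, mem_filtClosure_iff]
  refine ⟨fun N hN => hN.finite ?_, fun _ _ ⟨e⟩ h => h.of_equiv e, .zero,
    fun _ _ f hf hN => filtBuilt_of_injective hF hM f hf hN,
    fun _ _ _ f g hf hg hfg hA hN => .ext f g hf hg hfg hA hN⟩
  rintro N (hN | rfl)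
  · exact hF.1 N hN
  · exact hfg

theorem IsMinCoext.notMem {M : ModuleCat.{0} Λ} (hM : IsMinCoext Λ F M) : M ∉ F := by
  intro h
  have := hM.2.1
  obtain ⟨x, hx⟩ := exists_ne (0 : M)
  exact hx (LinearMap.congr_fun (hM.2.2.2.2 M h LinearMap.id) x)

theorem IsMinCoext.mem_or_exists_injective (hF : IsTorsionFreeClass Λ F) {M X : ModuleCat.{0} Λ}
    (hM : IsMinCoext Λ F M) (hX : X ∈ filtClosure Λ (F ∪ {M})) :
    X ∈ F ∨ ∃ f : M →ₗ[Λ] X, Function.Injective f := by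
  rw [mem_filtClosure_iff] at hX
  induction hX with
  | zero X hX => exact Or.inl (hF.2.2.1 X hX)
  | step A X N f g hf hg hfg _ hN ih =>
    rcases ih with hA | ⟨h, hh⟩
    · rcases hN with hN | rfl
      · exact Or.inl (hF.2.2.2.2 f g hf hg hfg hA hN)
      · by_cases hs : ∃ s : N →ₗ[Λ] X, g ∘ₗ s = LinearMap.id
        · obtain ⟨s, hs⟩ := hs
          exact Or.inr ⟨s, Function.LeftInverse.injective (LinearMap.congr_fun hs)⟩
        · exact Or.inl (hM.2.2.2.1 X A f g hf hg hfg hA hs)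
    · exact Or.inr ⟨f ∘ₗ h, hf.comp hh⟩

theorem IsMinCoext.torfCovers (hF : IsTorsionFreeClass Λ F) {M : ModuleCat.{0} Λ}
    (hM : IsMinCoext Λ F M) : TorfCovers Λ (filtClosure Λ (F ∪ {M})) F := by
  refine ⟨isTorsionFreeClass_filtClosure hF hM.1 hM.2.2.1,
    ⟨subset_filtClosure_union F M, fun h => hM.notMem (h (mem_filtClosure_self F M))⟩, ?_⟩
  intro F'' hF'' hlt hle
  obtain ⟨X, hX, hXF⟩ := Set.exists_of_ssubset hlt
  obtain ⟨f, hf⟩ := (hM.mem_or_exists_injective hF (hle hX)).resolve_left hXF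
  exact hle.antisymm (filtClosure_subset hF'' (Set.union_subset hlt.subset
    (Set.singleton_subset_iff.2 (hF''.2.2.2.1 f hf hX))))

theorem IsMinCoext.nonempty_equiv (hF : IsTorsionFreeClass Λ F) {M N : ModuleCat.{0} Λ}
    (hM : IsMinCoext Λ F M) (hN : IsMinCoext Λ F N)
    (h : filtClosure Λ (F ∪ {M}) = filtClosure Λ (F ∪ {N})) : Nonempty (M ≃ₗ[Λ] N) := by
  obtain ⟨f, hf⟩ := (hM.mem_or_exists_injective hF
    (h ▸ mem_filtClosure_self F N)).resolve_left hN.notMem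
  by_cases htop : LinearMap.range f = ⊤
  · exact ⟨LinearEquiv.ofBijective f ⟨hf, LinearMap.range_eq_top.1 htop⟩⟩
  · exact absurd (hF.2.1 ⟨(LinearEquiv.ofInjective f hf).symm⟩ (hN.2.2.1 _ htop)) hM.notMem

/-- A module outside `F` whose proper submodules all lie in `F` has no nonzero map to `F`. -/
theorem eq_zero_of_proper_submodules_mem (hF : IsTorsionFreeClass Λ F) {M : ModuleCat.{0} Λ}
    (hMF : M ∉ F) (hM : ∀ S : Submodule Λ M, S ≠ ⊤ → ModuleCat.of Λ ↥S ∈ F)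
    {Y : ModuleCat.{0} Λ} (hY : Y ∈ F) (f : M →ₗ[Λ] Y) : f = 0 := by
  by_contra hf
  refine hMF (hF.2.2.2.2 (A := ModuleCat.of Λ ↥(LinearMap.ker f))
    (B := ModuleCat.of Λ ↥(LinearMap.range f)) (Submodule.subtype _) f.rangeRestrict
    (Submodule.injective_subtype _) (LinearMap.surjective_rangeRestrict _) ?_
    (hM _ (fun h => hf (LinearMap.ker_eq_top.1 h)))
    (hF.2.2.2.1 (Submodule.subtype _) (Submodule.injective_subtype _) hY))
  rw [Submodule.range_subtype, LinearMap.ker_rangeRestrict]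

theorem exists_minimal_notMem [IsArtinianRing Λ] (hF : IsTorsionFreeClass Λ F)
    {X : ModuleCat.{0} Λ} (hX : FG Λ X) (hXF : X ∉ F) :
    ∃ S : Submodule Λ X, ModuleCat.of Λ ↥S ∉ F ∧
      ∀ T : Submodule Λ ↥S, T ≠ ⊤ → ModuleCat.of Λ ↥T ∈ F := by
  have htop : ModuleCat.of Λ ↥(⊤ : Submodule Λ X) ∉ F :=
    fun h => hXF (hF.2.1 ⟨Submodule.topEquiv⟩ h)
  obtain ⟨S, hS, hmin⟩ := IsArtinian.set_has_minimal
    {S : Submodule Λ X | ModuleCat.of Λ ↥S ∉ F} ⟨⊤, htop⟩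
  refine ⟨S, hS, fun T hT => ?_⟩
  have hlt : T.map S.subtype < S := by
    refine lt_of_le_of_ne (Submodule.map_subtype_le S T) fun h => hT ?_
    rw [← Submodule.comap_map_eq_of_injective S.injective_subtype T, h,
      Submodule.comap_subtype_self]
  have hmem : ModuleCat.of Λ ↥(T.map S.subtype) ∈ F := by
    by_contra h
    exact hmin _ h hlt
  exact hF.2.1 ⟨(Submodule.equivMapOfInjective S.subtype S.injective_subtype T).symm⟩ hmem

/-- The modules of `C` receiving no nonzero map from `M` form a torsion-free class. -/
theorem IsTorsionFreeClass.inter_hom_eq_zero {C : Set (ModuleCat.{0} Λ)}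
    (hC : IsTorsionFreeClass Λ C) (M : ModuleCat.{0} Λ) :
    IsTorsionFreeClass Λ {Z | Z ∈ C ∧ ∀ f : M →ₗ[Λ] Z, f = 0} := by
  have hsub : SubClosed Λ {Z | Z ∈ C ∧ ∀ f : M →ₗ[Λ] Z, f = 0} := by
    intro N Z f hf hZ
    refine ⟨hC.2.2.2.1 f hf hZ.1, fun h => LinearMap.ext fun x => hf ?_⟩
    simpa using LinearMap.congr_fun (hZ.2 (f ∘ₗ h)) x
  refine ⟨fun Z hZ => hC.1 Z hZ.1, fun Z N ⟨e⟩ hZ => hsub e.symm.toLinearMap e.symm.injective hZ,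
    fun Z hZ => ⟨hC.2.2.1 Z hZ, fun f => LinearMap.ext fun _ => Subsingleton.elim _ _⟩, hsub, ?_⟩
  intro A Z N f g hf hg hfg hA hN
  refine ⟨hC.2.2.2.2 f g hf hg hfg hA.1 hN.1, fun h => ?_⟩
  have hmem : ∀ x, h x ∈ LinearMap.range f := by
    intro x
    rw [hfg]
    exact LinearMap.congr_fun (hN.2 (g ∘ₗ h)) x
  have h0 := hA.2 ((LinearEquiv.ofInjective f hf).symm.toLinearMap ∘ₗ LinearMap.codRestrict _ h hmem)
  ext x
  have hx : (LinearEquiv.ofInjective f hf).symm (LinearMap.codRestrict _ h hmem x) = 0 :=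
    LinearMap.congr_fun h0 x
  rw [LinearEquiv.map_eq_zero_iff] at hx
  exact congrArg Subtype.val hx

theorem TorfCovers.exists_isMinCoext [IsArtinianRing Λ] (hF : IsTorsionFreeClass Λ F)
    {F' : Set (ModuleCat.{0} Λ)} (h : TorfCovers Λ F' F) :
    ∃ M, IsMinCoext Λ F M ∧ filtClosure Λ (F ∪ {M}) = F' := by
  obtain ⟨hF', hlt, hcov⟩ := h
  obtain ⟨X, hX, hXF⟩ := Set.exists_of_ssubset hlt
  obtain ⟨S, hS, hprop⟩ := exists_minimal_notMem hF (hF'.1 X hX) hXF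
  set M := ModuleCat.of Λ ↥S
  have hMF' : M ∈ F' := hF'.2.2.2.1 (M := M) S.subtype S.injective_subtype hX
  have hMfg : FG Λ M := hF'.1 M hMF'
  have hhom : ∀ Y ∈ F, ∀ f : M →ₗ[Λ] Y, f = 0 :=
    fun Y hY f => eq_zero_of_proper_submodules_mem hF hS hprop hY f
  have hnt : Nontrivial M := not_subsingleton_iff_nontrivial.1 fun hs => hS (hF.2.2.1 M hs)
  have hperp : ∀ Z ∈ F', (∀ f : M →ₗ[Λ] Z, f = 0) → Z ∈ F := by
    intro Z hZ hMZ
    by_contra hZF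
    have heq := hcov _ (hF'.inter_hom_eq_zero M)
      ⟨fun Y hY => ⟨hlt.subset hY, hhom Y hY⟩, fun hle => hZF (hle ⟨hZ, hMZ⟩)⟩ fun _ hY => hY.1
    have hM0 := (heq.symm ▸ hMF' : M ∈ {Z | Z ∈ F' ∧ ∀ f : M →ₗ[Λ] Z, f = 0}).2 LinearMap.id
    obtain ⟨x, hx⟩ := exists_ne (0 : M)
    exact hx (LinearMap.congr_fun hM0 x)
  refine ⟨M, ⟨hMfg, hnt, hprop, ?_, hhom⟩, ?_⟩
  · intro E Y f g hf hg hfg hY hsplit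
    by_contra hE
    have hEF' : E ∈ F' := hF'.2.2.2.2 f g hf hg hfg (hlt.subset hY) hMF'
    refine hE (hperp E hEF' fun k => ?_)
    by_contra hk
    by_cases htop : LinearMap.range (g ∘ₗ k) = ⊤
    · have hbij : Function.Bijective (g ∘ₗ k) :=
        IsNoetherian.bijective_of_surjective_endomorphism _ (LinearMap.range_eq_top.1 htop)
      let e := LinearEquiv.ofBijective (g ∘ₗ k) hbij
      exact hsplit ⟨k ∘ₗ e.symm.toLinearMap, LinearMap.ext fun x => e.apply_symm_apply x⟩
    · have h0 : (g ∘ₗ k).rangeRestrict = 0 :=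
        hhom (ModuleCat.of Λ ↥(LinearMap.range (g ∘ₗ k))) (hprop _ htop) _
      have hker : ∀ x, k x ∈ LinearMap.range f := by
        intro x
        rw [hfg]
        exact congrArg Subtype.val (LinearMap.congr_fun h0 x)
      have hr : ModuleCat.of Λ ↥(LinearMap.range f) ∈ F :=
        hF.2.1 ⟨LinearEquiv.ofInjective f hf⟩ hY
      have hk0 := hhom _ hr (LinearMap.codRestrict _ k hker)
      exact hk (LinearMap.ext fun x => congrArg Subtype.val (LinearMap.congr_fun hk0 x))
  · exact hcov _ (isTorsionFreeClass_filtClosure hF hMfg hprop)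
      ⟨subset_filtClosure_union F M, fun hle => hS (hle (mem_filtClosure_self F M))⟩
      (filtClosure_subset hF' (Set.union_subset hlt.subset (Set.singleton_subset_iff.2 hMF')))

end TorsionFree

/-- For a torsion-free class `F` in `mod Λ`, the map `M ↦ Filt(F ∪ {M})` is a
bijection from the set of isomorphism classes of minimal co-extending modules for `F` onto the
set of torsion-free classes covering `F`. -/
theorem minCoext_biject_with_covers_of_torsionFree_class
    (K Λ : Type) [Field K] [Ring Λ] [Algebra K Λ] [FiniteDimensional K Λ]
    (F : Set (ModuleCat.{0} Λ)) (hF : IsTorsionFreeClass Λ F) :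
    (∀ M, IsMinCoext Λ F M → TorfCovers Λ (filtClosure Λ (F ∪ {M})) F) ∧
    (∀ F', TorfCovers Λ F' F → ∃ M, IsMinCoext Λ F M ∧ filtClosure Λ (F ∪ {M}) = F') ∧
    (∀ M N, IsMinCoext Λ F M → IsMinCoext Λ F N →
        filtClosure Λ (F ∪ {M}) = filtClosure Λ (F ∪ {N}) → Nonempty (M ≃ₗ[Λ] N)) := by
  have : IsArtinianRing Λ := IsArtinianRing.of_finite K Λ
  exact ⟨fun _ hM => hM.torfCovers hF, fun _ h => h.exists_isMinCoext hF,
    fun _ _ hM hN h => hM.nonempty_equiv hF hN h⟩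

end BrickPaper
end

section
/- Let Λ be a finite-dimensional algebra over a field K, T a torsion class and F a torsion-free class in mod Λ. Then every minimal extending module for T is a brick, every minimal co-extending module for F is a brick, the set of isomorphism classes of minimal extending modules for T forms a semibrick, and the set of isomorphism classes of minimal co-extending modules for F forms a semibrick. -/
open Function DirectSum

namespace BrickPaper

variable (Λ : Type) [Ring Λ]

section

variable {Λ}

lemma IsMinExt.bijective_of_ne_zero {T : Set (ModuleCat.{0} Λ)} {M N : ModuleCat.{0} Λ}
    (hM : IsMinExt Λ T M) (hN : IsMinExt Λ T N) (f : M →ₗ[Λ] N) (hf : f ≠ 0) :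
    Function.Bijective f := by
  obtain ⟨-, -, hMquot, hMext, -⟩ := hM
  obtain ⟨-, hNnt, hNquot, -, hNhom⟩ := hN
  have hinj : Function.Injective f := by
    rw [← LinearMap.ker_eq_bot]
    by_contra hker
    have hzero := hNhom _ (hMquot _ hker) ((LinearMap.ker f).liftQ f le_rfl)
    refine hf ?_
    rw [← (LinearMap.ker f).liftQ_mkQ f le_rfl, hzero, LinearMap.zero_comp]
  refine ⟨hinj, ?_⟩
  have hrange : LinearMap.range f ≠ ⊥ := by rwa [Ne, LinearMap.range_eq_bot]
  have hcoker := hNquot _ hrange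
  by_cases hsplit : ∃ r : N →ₗ[Λ] M, r ∘ₗ f = LinearMap.id
  · obtain ⟨r, hr⟩ := hsplit
    have hle : LinearMap.range f ≤ LinearMap.ker (LinearMap.id - f ∘ₗ r) := by
      rintro _ ⟨m, rfl⟩
      simp [show r (f m) = m from LinearMap.congr_fun hr m]
    have hzero : LinearMap.id - f ∘ₗ r = 0 := by
      rw [← (LinearMap.range f).liftQ_mkQ _ hle, hNhom _ hcoker (Submodule.liftQ _ _ hle),
        LinearMap.zero_comp]
    exact fun n => ⟨r n, (LinearMap.congr_fun (sub_eq_zero.mp hzero) n).symm⟩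
  · have hNT : N ∈ T := hMext N _ f (LinearMap.range f).mkQ hinj
      (LinearMap.range f).mkQ_surjective (LinearMap.range f).ker_mkQ.symm hcoker hsplit
    obtain ⟨n, hn⟩ := exists_ne (0 : N)
    exact absurd (LinearMap.congr_fun (hNhom N hNT LinearMap.id) n) hn

lemma IsMinCoext.bijective_of_ne_zero {F : Set (ModuleCat.{0} Λ)} {M N : ModuleCat.{0} Λ}
    (hM : IsMinCoext Λ F M) (hN : IsMinCoext Λ F N) (f : M →ₗ[Λ] N) (hf : f ≠ 0) :
    Function.Bijective f := by
  obtain ⟨-, hMnt, hMsub, -, hMhom⟩ := hM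
  obtain ⟨-, -, hNsub, hNext, -⟩ := hN
  have hsurj : Function.Surjective f := by
    rw [← LinearMap.range_eq_top]
    by_contra hrange
    have hzero := hMhom _ (hNsub _ hrange) f.rangeRestrict
    refine hf ?_
    rw [← LinearMap.subtype_comp_codRestrict _ _ (LinearMap.mem_range_self f)]
    exact (congrArg (fun g => (LinearMap.range f).subtype ∘ₗ g) hzero).trans
      (LinearMap.comp_zero _)
  refine ⟨?_, hsurj⟩
  have hker : LinearMap.ker f ≠ ⊤ := by rwa [Ne, LinearMap.ker_eq_top]
  have hkerF := hMsub _ hker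
  by_cases hsplit : ∃ s : N →ₗ[Λ] M, f ∘ₗ s = LinearMap.id
  · obtain ⟨s, hs⟩ := hsplit
    have hmem (m : M) : (LinearMap.id - s ∘ₗ f : M →ₗ[Λ] M) m ∈ LinearMap.ker f := by
      simp [show f (s (f m)) = f m from LinearMap.congr_fun hs (f m)]
    have hzero := hMhom _ hkerF (LinearMap.codRestrict _ _ hmem)
    have hleft (m : M) : s (f m) = m :=
      (sub_eq_zero.mp (congrArg Subtype.val (LinearMap.congr_fun hzero m))).symm
    exact Function.LeftInverse.injective hleft
  · have hMF : M ∈ F := hNext M _ (LinearMap.ker f).subtype f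
      (LinearMap.ker f).injective_subtype hsurj (LinearMap.ker f).range_subtype hkerF hsplit
    obtain ⟨m, hm⟩ := exists_ne (0 : M)
    exact absurd (LinearMap.congr_fun (hMhom M hMF LinearMap.id) m) hm

lemma IsMinExt.isBrick {T : Set (ModuleCat.{0} Λ)} {M : ModuleCat.{0} Λ}
    (hM : IsMinExt Λ T M) : IsBrick Λ M :=
  ⟨hM.1, hM.2.1, hM.bijective_of_ne_zero hM⟩

lemma IsMinCoext.isBrick {F : Set (ModuleCat.{0} Λ)} {M : ModuleCat.{0} Λ}
    (hM : IsMinCoext Λ F M) : IsBrick Λ M :=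
  ⟨hM.1, hM.2.1, hM.bijective_of_ne_zero hM⟩

lemma isoClosed_ME {T : Set (ModuleCat.{0} Λ)} (hT : QuotClosed Λ T) :
    IsoClosed Λ (ME Λ T) := by
  rintro M N ⟨e⟩ ⟨hfin, hnt, hquot, hext, hhom⟩
  refine ⟨Module.Finite.equiv e, e.symm.toEquiv.nontrivial, fun S hS => ?_,
    fun X T' f g hf hg hfg hT' hsplit => ?_, fun X hX f => ?_⟩
  · have hcomap : S.comap e.toLinearMap ≠ ⊥ := fun h => hS <| by
      rw [← Submodule.map_comap_eq_of_surjective e.surjective S]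
      exact (congrArg (Submodule.map e.toLinearMap) h).trans (Submodule.map_bot _)
    refine hT (M := ModuleCat.of Λ (M ⧸ S.comap e.toLinearMap))
      ((S.comap e.toLinearMap).mapQ S e.toLinearMap le_rfl) ?_ (hquot _ hcomap)
    rintro ⟨n⟩
    exact ⟨Submodule.Quotient.mk (e.symm n), congrArg Submodule.Quotient.mk
      (e.apply_symm_apply n)⟩
  · refine hext X T' (f ∘ₗ e.toLinearMap) g (hf.comp e.injective) hg ?_ hT' ?_
    · rw [LinearMap.range_comp_of_range_eq_top _ e.range, hfg]
    · rintro ⟨r, hr⟩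
      refine hsplit ⟨e.toLinearMap ∘ₗ r, LinearMap.ext fun n => ?_⟩
      exact e.eq_symm_apply.mp (by simpa using LinearMap.congr_fun hr (e.symm n))
  · have hzero := hhom X hX (e.symm.toLinearMap ∘ₗ f)
    ext x
    simpa using LinearMap.congr_fun hzero x

lemma isoClosed_MCE {F : Set (ModuleCat.{0} Λ)} (hF : SubClosed Λ F) :
    IsoClosed Λ (MCE Λ F) := by
  rintro M N ⟨e⟩ ⟨hfin, hnt, hsub, hext, hhom⟩
  refine ⟨Module.Finite.equiv e, e.symm.toEquiv.nontrivial, fun S hS => ?_,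
    fun X F' f g hf hg hfg hF' hsplit => ?_, fun Y hY f => ?_⟩
  · have hmap : S.map e.symm.toLinearMap ≠ ⊤ := fun h => hS <| by
      rw [← Submodule.comap_map_eq_of_injective e.symm.injective S]
      exact (congrArg (Submodule.comap e.symm.toLinearMap) h).trans (Submodule.comap_top _)
    exact hF (N := ModuleCat.of Λ (S.map e.symm.toLinearMap))
      (e.symm.submoduleMap S).toLinearMap (e.symm.submoduleMap S).injective (hsub _ hmap)
  · refine hext X F' f (e.symm.toLinearMap ∘ₗ g) hf (e.symm.surjective.comp hg) ?_ hF' ?_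
    · rw [LinearMap.ker_comp_of_ker_eq_bot _ e.symm.ker, hfg]
    · rintro ⟨s, hs⟩
      refine hsplit ⟨s ∘ₗ e.symm.toLinearMap, LinearMap.ext fun n => ?_⟩
      exact e.symm.injective (LinearMap.congr_fun hs (e.symm n))
  · have hzero := hhom Y hY (f ∘ₗ e.toLinearMap)
    ext n
    simpa using LinearMap.congr_fun hzero (e.symm n)

lemma isSemibrick_ME {T : Set (ModuleCat.{0} Λ)} (hT : QuotClosed Λ T) :
    IsSemibrick Λ (ME Λ T) :=
  ⟨fun _ hM => IsMinExt.isBrick hM, isoClosed_ME hT, fun _ hM _ hN hiso f =>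
    of_not_not fun hf => hiso.elim
      (LinearEquiv.ofBijective f (IsMinExt.bijective_of_ne_zero hM hN f hf))⟩

lemma isSemibrick_MCE {F : Set (ModuleCat.{0} Λ)} (hF : SubClosed Λ F) :
    IsSemibrick Λ (MCE Λ F) :=
  ⟨fun _ hM => IsMinCoext.isBrick hM, isoClosed_MCE hF, fun _ hM _ hN hiso f =>
    of_not_not fun hf => hiso.elim
      (LinearEquiv.ofBijective f (IsMinCoext.bijective_of_ne_zero hM hN f hf))⟩

end

/-- Minimal extending modules for a torsion class and minimal co-extending
modules for a torsion-free class are bricks, and each of `ME(T)` and `MCE(F)` is a semibrick. -/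
theorem minExt_isBrick_and_ME_MCE_semibricks
    (K Λ : Type) [Field K] [Ring Λ] [Algebra K Λ] [FiniteDimensional K Λ]
    (T F : Set (ModuleCat.{0} Λ)) (hT : IsTorsionClass Λ T) (hF : IsTorsionFreeClass Λ F) :
    (∀ M, IsMinExt Λ T M → IsBrick Λ M) ∧
    (∀ M, IsMinCoext Λ F M → IsBrick Λ M) ∧
    IsSemibrick Λ (ME Λ T) ∧ IsSemibrick Λ (MCE Λ F) := by
  exact ⟨fun _ => IsMinExt.isBrick, fun _ => IsMinCoext.isBrick,
    isSemibrick_ME hT.2.2.2.1, isSemibrick_MCE hF.2.2.2.1⟩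

end BrickPaper
end

section
/- Let Λ be a finite-dimensional algebra over a field K. If W1 ⊆ W2 ⊆ W3 ⊆ ⋯ is an increasing chain of wide subcategories of mod Λ, then the union W = ⋃_{i≥1} Wi is a wide subcategory of mod Λ, and if the chain is strictly increasing then the semibrick sim(W) of simple objects of W is infinite. -/
open Function DirectSum

namespace BrickPaper

variable (Λ : Type) [Ring Λ]

theorem isWide_iUnion_of_monotone {W : ℕ → Set (ModuleCat.{0} Λ)}
    (hwide : ∀ n, IsWide Λ (W n)) (hW : Monotone W) : IsWide Λ (⋃ n, W n) := by
  simp only [IsWide, IsoClosed, HasZeroObj, KerClosed, CokerClosed, ExtClosed, Set.mem_iUnion]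
  refine ⟨?_, ?_, ?_, ?_, ?_, ?_⟩
  · rintro M ⟨n, hM⟩
    exact (hwide n).1 M hM
  · rintro M N e ⟨n, hM⟩
    exact ⟨n, (hwide n).2.1 e hM⟩
  · intro M hM
    exact ⟨0, (hwide 0).2.2.1 M hM⟩
  · rintro M N f ⟨m, hM⟩ ⟨n, hN⟩
    exact ⟨max m n, (hwide _).2.2.2.1 f (hW (le_max_left m n) hM) (hW (le_max_right m n) hN)⟩
  · rintro M N f ⟨m, hM⟩ ⟨n, hN⟩
    exact ⟨max m n, (hwide _).2.2.2.2.1 f (hW (le_max_left m n) hM) (hW (le_max_right m n) hN)⟩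
  · rintro A M B f g hf hg hfg ⟨m, hA⟩ ⟨n, hB⟩
    exact ⟨max m n, (hwide _).2.2.2.2.2 f g hf hg hfg (hW (le_max_left m n) hA)
      (hW (le_max_right m n) hB)⟩

/-- A wide subcategory over an artinian ring is contained in any wide subcategory
containing its simple objects. -/
theorem IsWide.subset_of_simOf_subset [IsArtinianRing Λ] {C D : Set (ModuleCat.{0} Λ)}
    (hC : IsWide Λ C) (hD : IsWide Λ D) (h : simOf Λ C ⊆ D) : C ⊆ D := by
  intro M
  induction hl : Module.length Λ M using WellFoundedLT.induction generalizing M with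
  | ind l ih =>
    intro hM
    subst hl
    have : Module.Finite Λ M := hC.1 M hM
    rcases subsingleton_or_nontrivial M with hs | hn
    · exact hD.2.2.1 M hs
    by_cases hsim : M ∈ simOf Λ C
    · exact h hsim
    obtain ⟨X, f, hX, hf, hbot, htop⟩ : ∃ (X : ModuleCat.{0} Λ) (f : X →ₗ[Λ] M), X ∈ C ∧
        Injective f ∧ LinearMap.range f ≠ ⊥ ∧ LinearMap.range f ≠ ⊤ := by
      by_contra! hcon
      exact hsim ⟨hM, hn, fun X f hX hf => or_iff_not_imp_left.2 (hcon X f hX hf)⟩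
    have hXD : X ∈ D := by
      refine ih _ ?_ rfl hX
      rw [(LinearEquiv.ofInjective f hf).length_eq]
      exact Submodule.length_lt htop
    have hQD : ModuleCat.of Λ (M ⧸ LinearMap.range f) ∈ D :=
      ih _ (Submodule.length_quotient_lt _ hbot) rfl (hC.2.2.2.2.1 f hX hM)
    exact hD.2.2.2.2.2 f (LinearMap.range f).mkQ hf (Submodule.mkQ_surjective _)
      (Submodule.ker_mkQ _).symm hXD hQD

/-- An isomorphism-finite class covered by a chain of isomorphism-closed classes is
contained in a single term of the chain. -/
theorem FiniteUpToIso.exists_subset_of_monotone {S : Set (ModuleCat.{0} Λ)}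
    (hS : FiniteUpToIso Λ S) {W : ℕ → Set (ModuleCat.{0} Λ)} (hiso : ∀ n, IsoClosed Λ (W n))
    (hW : Monotone W) (hSW : S ⊆ ⋃ n, W n) : ∃ n, S ⊆ W n := by
  obtain ⟨B, hB, hSB⟩ := hS
  have hbound : ∀ N ∈ B, ∃ n, ∀ M ∈ S, Nonempty (M ≃ₗ[Λ] N) → M ∈ W n := by
    intro N _
    by_cases hN : ∃ M ∈ S, Nonempty (M ≃ₗ[Λ] N)
    · obtain ⟨M, hM, ⟨e⟩⟩ := hN
      obtain ⟨n, hn⟩ := Set.mem_iUnion.1 (hSW hM)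
      exact ⟨n, fun M' _ ⟨e'⟩ => hiso n ⟨e.trans e'.symm⟩ hn⟩
    · exact ⟨0, fun M hM e => (hN ⟨M, hM, e⟩).elim⟩
  choose! k hk using hbound
  obtain ⟨n, hn⟩ := (hB.image k).bddAbove
  refine ⟨n, fun M hM => ?_⟩
  obtain ⟨N, hN, e⟩ := hSB M hM
  exact hW (hn (Set.mem_image_of_mem k hN)) (hk N hN M hM e)

/-- The union of an increasing chain of wide subcategories of `mod Λ` is a wide
subcategory, and if the chain is strictly increasing then the semibrick of simple objects of the
union is infinite. -/
theorem union_of_wide_chain_is_wide_and_sim_infinite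
    (K Λ : Type) [Field K] [Ring Λ] [Algebra K Λ] [FiniteDimensional K Λ]
    (W : ℕ → Set (ModuleCat.{0} Λ)) (hwide : ∀ n, IsWide Λ (W n))
    (hmono : ∀ n, W n ⊆ W (n + 1)) :
    IsWide Λ (⋃ n, W n) ∧
      ((∀ n, W n ⊂ W (n + 1)) → ¬ FiniteUpToIso Λ (simOf Λ (⋃ n, W n))) := by
  have hW : Monotone W := monotone_nat_of_le_succ hmono
  have hU := isWide_iUnion_of_monotone Λ hwide hW
  refine ⟨hU, fun hstrict hfin => ?_⟩
  have : IsArtinianRing Λ := isArtinian_of_tower K inferInstance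
  obtain ⟨n, hn⟩ := hfin.exists_subset_of_monotone Λ (fun n => (hwide n).2.1) hW fun _ hM => hM.1
  exact (hstrict n).2
    ((Set.subset_iUnion W (n + 1)).trans (hU.subset_of_simOf_subset Λ (hwide n) hn))

end BrickPaper
end

section
/- Let Λ be a finite-dimensional algebra over a field K. For wide subcategories W1, W2 of mod Λ with smallest containing torsion classes T(W1), T(W2), one has T(W1) ⊆ T(W2) with κ̄(T(W1)) ⊇ κ̄(T(W2)) and T(W1) ≠ T(W2) if and only if W1 ⊊ W2; consequently the map W ↦ T(W) is a poset isomorphism from the poset of wide subcategories of mod Λ ordered by inclusion onto the set of torsion classes admitting a canonical join representation, equipped with the kappa order. -/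
open Function DirectSum

namespace BrickPaper

variable (Λ : Type) [Ring Λ]

section Auxiliary

variable {Λ}

section Linear

variable {X Y Z : Type} [AddCommGroup X] [Module Λ X] [AddCommGroup Y] [Module Λ Y]
  [AddCommGroup Z] [Module Λ Z]

theorem exists_factor_of_surjective (g : X →ₗ[Λ] Y) (hg : Function.Surjective g) (h : X →ₗ[Λ] Z)
    (hle : LinearMap.ker g ≤ LinearMap.ker h) : ∃ k : Y →ₗ[Λ] Z, ∀ x, k (g x) = h x :=
  ⟨(LinearMap.ker g).liftQ h hle ∘ₗ (g.quotKerEquivOfSurjective hg).symm.toLinearMap, fun x => by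
    simp⟩

theorem exists_minimal_submodule [IsArtinianRing Λ] [Module.Finite Λ X]
    (p : Submodule Λ X → Prop) (hp : ∃ N, p N) :
    ∃ N, p N ∧ ∀ N', p N' → N' ≤ N → N' = N := by
  obtain ⟨N, hN, h⟩ := IsArtinian.set_has_minimal {N | p N} hp
  exact ⟨N, hN, fun N' hN' hle => by_contra fun hne => h N' hN' (lt_of_le_of_ne hle hne)⟩

theorem exists_maximal_submodule [IsArtinianRing Λ] [Module.Finite Λ X]
    (p : Submodule Λ X → Prop) (hp : ∃ N, p N) :
    ∃ N, p N ∧ ∀ N', p N' → N ≤ N' → N' = N := by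
  obtain ⟨N, hN, h⟩ := set_has_maximal_iff_noetherian.mpr
    (inferInstance : IsNoetherian Λ X) {N | p N} hp
  exact ⟨N, hN, fun N' hN' hle => by_contra fun hne =>
    h N' hN' (lt_of_le_of_ne hle (Ne.symm hne))⟩

theorem ExtClosed.of_submodule {C : Set (ModuleCat.{0} Λ)} (hC : ExtClosed Λ C)
    (N : Submodule Λ X) (hN : ModuleCat.of Λ N ∈ C) (hQ : ModuleCat.of Λ (X ⧸ N) ∈ C) :
    ModuleCat.of Λ X ∈ C :=
  hC (A := ModuleCat.of Λ N) (M := ModuleCat.of Λ X) (B := ModuleCat.of Λ (X ⧸ N))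
    N.subtype N.mkQ N.injective_subtype N.mkQ_surjective (by simp) hN hQ

theorem QuotClosed.of_surjective {C : Set (ModuleCat.{0} Λ)} (hC : QuotClosed Λ C)
    (g : X →ₗ[Λ] Y) (hg : Function.Surjective g) (hX : ModuleCat.of Λ X ∈ C) :
    ModuleCat.of Λ Y ∈ C :=
  hC (M := ModuleCat.of Λ X) (N := ModuleCat.of Λ Y) g hg hX

theorem IsoClosed.of_equiv {C : Set (ModuleCat.{0} Λ)} (hC : IsoClosed Λ C)
    (e : X ≃ₗ[Λ] Y) (hX : ModuleCat.of Λ X ∈ C) : ModuleCat.of Λ Y ∈ C :=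
  hC (M := ModuleCat.of Λ X) (N := ModuleCat.of Λ Y) ⟨e⟩ hX

/-- An extension-closed class containing `N ≤ X` and `P ≤ X ⧸ N` contains the preimage of `P`
in `X`. -/
theorem ExtClosed.comap_mkQ {C : Set (ModuleCat.{0} Λ)} (hC : ExtClosed Λ C)
    (N : Submodule Λ X) (P : Submodule Λ (X ⧸ N)) (hN : ModuleCat.of Λ N ∈ C)
    (hP : ModuleCat.of Λ P ∈ C) : ModuleCat.of Λ (P.comap N.mkQ) ∈ C := by
  have hle : N ≤ P.comap N.mkQ := fun x hx => by
    simp [(Submodule.Quotient.mk_eq_zero N).mpr hx]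
  refine hC (A := ModuleCat.of Λ N) (M := ModuleCat.of Λ (P.comap N.mkQ)) (B := ModuleCat.of Λ P)
    (Submodule.inclusion hle) (N.mkQ.restrict fun x hx => hx)
    (Submodule.inclusion_injective hle) ?_ ?_ hN hP
  · rintro ⟨p, hp⟩
    obtain ⟨x, rfl⟩ := N.mkQ_surjective p
    exact ⟨⟨x, hp⟩, rfl⟩
  · ext ⟨x, hx⟩
    constructor
    · rintro ⟨n, hn⟩
      have : (n : X) = x := congrArg Subtype.val hn
      rw [LinearMap.mem_ker]
      apply Subtype.ext
      exact (Submodule.Quotient.mk_eq_zero N).mpr (this ▸ n.2)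
    · intro h
      have h' : N.mkQ x = 0 := congrArg Subtype.val (LinearMap.mem_ker.mp h)
      exact ⟨⟨x, (Submodule.Quotient.mk_eq_zero N).mp h'⟩, rfl⟩

end Linear

theorem isTorsionClass_fg : IsTorsionClass Λ {M | FG Λ M} := by
  refine ⟨fun M hM => hM, ?_, ?_, ?_, ?_⟩
  · rintro M N ⟨e⟩ hM
    have : Module.Finite Λ M := hM
    exact Module.Finite.equiv e
  · intro M hM
    exact Module.Finite.of_finite
  · intro M N g hg hM
    have : Module.Finite Λ M := hM
    exact Module.Finite.of_surjective g hg
  · intro A M B f g hf hg hfg hA hB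
    have : Module.Finite Λ A := hA
    have : Module.Finite Λ B := hB
    have : Module.Finite Λ (LinearMap.ker g) := hfg ▸ inferInstance
    have : Module.Finite Λ (M ⧸ LinearMap.ker g) :=
      Module.Finite.equiv (g.quotKerEquivOfSurjective hg).symm
    exact Module.Finite.of_submodule_quotient (LinearMap.ker g)

theorem isTorsionClass_sInter {𝒞 : Set (Set (ModuleCat.{0} Λ))} (h𝒞 : ∀ C ∈ 𝒞, IsTorsionClass Λ C)
    (hne : 𝒞.Nonempty) : IsTorsionClass Λ (⋂₀ 𝒞) := by
  obtain ⟨C₀, hC₀⟩ := hne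
  exact ⟨fun M hM => (h𝒞 C₀ hC₀).1 M (hM C₀ hC₀),
    fun M N e hM C hC => (h𝒞 C hC).2.1 e (hM C hC),
    fun M hM C hC => (h𝒞 C hC).2.2.1 M hM,
    fun M N g hg hM C hC => (h𝒞 C hC).2.2.2.1 g hg (hM C hC),
    fun A M B f g hf hg hfg hA hB C hC =>
      (h𝒞 C hC).2.2.2.2 f g hf hg hfg (hA C hC) (hB C hC)⟩

theorem IsTorsionClass.inter {C D : Set (ModuleCat.{0} Λ)} (hC : IsTorsionClass Λ C)
    (hD : IsTorsionClass Λ D) : IsTorsionClass Λ (C ∩ D) := by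
  rw [← Set.sInter_pair]
  exact isTorsionClass_sInter (by rintro E (rfl | rfl) <;> assumption) ⟨C, by simp⟩

theorem isTorsionClass_torsClosure {X : Set (ModuleCat.{0} Λ)} (hX : ∀ M ∈ X, FG Λ M) :
    IsTorsionClass Λ (torsClosure Λ X) :=
  isTorsionClass_sInter (fun _ hC => hC.1) ⟨_, isTorsionClass_fg, hX⟩

theorem subset_torsClosure (X : Set (ModuleCat.{0} Λ)) : X ⊆ torsClosure Λ X :=
  fun _ hM _ hC => hC.2 hM

theorem torsClosure_subset {X C : Set (ModuleCat.{0} Λ)} (hC : IsTorsionClass Λ C) (h : X ⊆ C) :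
    torsClosure Λ X ⊆ C :=
  Set.sInter_subset_of_mem ⟨hC, h⟩

theorem isTorsionClass_torsJoin {A : Set (Set (ModuleCat.{0} Λ))}
    (hA : ∀ a ∈ A, IsTorsionClass Λ a) : IsTorsionClass Λ (torsJoin Λ A) :=
  isTorsionClass_torsClosure fun M ⟨a, ha, hM⟩ => (hA a ha).1 M hM

theorem subset_torsJoin {A : Set (Set (ModuleCat.{0} Λ))} {a : Set (ModuleCat.{0} Λ)}
    (ha : a ∈ A) : a ⊆ torsJoin Λ A :=
  (Set.subset_sUnion_of_mem ha).trans (subset_torsClosure _)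

theorem torsJoin_subset {A : Set (Set (ModuleCat.{0} Λ))} {C : Set (ModuleCat.{0} Λ)}
    (hC : IsTorsionClass Λ C) (h : ∀ a ∈ A, a ⊆ C) : torsJoin Λ A ⊆ C :=
  torsClosure_subset hC (Set.sUnion_subset h)

theorem isTorsionClass_lPerp (F : Set (ModuleCat.{0} Λ)) : IsTorsionClass Λ (lPerp Λ F) := by
  refine ⟨fun M hM => hM.1, ?_, ?_, ?_, ?_⟩
  · rintro M N ⟨e⟩ hM
    refine ⟨isTorsionClass_fg.2.1 ⟨e⟩ hM.1, fun Y hY f => ?_⟩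
    have := hM.2 Y hY (f ∘ₗ e.toLinearMap)
    ext n
    simpa using LinearMap.congr_fun this (e.symm n)
  · intro M hM
    exact ⟨isTorsionClass_fg.2.2.1 M hM, fun Y _ f => Subsingleton.elim _ _⟩
  · intro M N g hg hM
    refine ⟨isTorsionClass_fg.2.2.2.1 g hg hM.1, fun Y hY f => ?_⟩
    ext n
    obtain ⟨m, rfl⟩ := hg n
    exact LinearMap.congr_fun (hM.2 Y hY (f ∘ₗ g)) m
  · intro A M B f g hf hg hfg hA hB
    refine ⟨isTorsionClass_fg.2.2.2.2 f g hf hg hfg hA.1 hB.1, fun Y hY h => ?_⟩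
    have h0 := hA.2 Y hY (h ∘ₗ f)
    obtain ⟨k, hk⟩ := exists_factor_of_surjective g hg h (by
      rw [← hfg]
      rintro _ ⟨a, rfl⟩
      exact LinearMap.congr_fun h0 a)
    ext m
    rw [← hk, hB.2 Y hY k]
    rfl

/-- The torsion part of a finitely generated module. -/
theorem IsTorsionClass.exists_torsion_part [IsArtinianRing Λ] {T : Set (ModuleCat.{0} Λ)}
    (hT : IsTorsionClass Λ T) (M : Type) [AddCommGroup M] [Module Λ M] [Module.Finite Λ M] :
    ∃ t : Submodule Λ M, ModuleCat.of Λ t ∈ T ∧ ModuleCat.of Λ (M ⧸ t) ∈ rPerp Λ T := by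
  obtain ⟨t, ht, hmax⟩ := exists_maximal_submodule (Λ := Λ)
    (fun N : Submodule Λ M => ModuleCat.of Λ N ∈ T)
    ⟨⊥, hT.2.2.1 _ (inferInstanceAs (Subsingleton (⊥ : Submodule Λ M)))⟩
  refine ⟨t, ht, inferInstanceAs (Module.Finite Λ (M ⧸ t)), fun X hX f => ?_⟩
  have hr : ModuleCat.of Λ (LinearMap.range f) ∈ T :=
    hT.2.2.2.1.of_surjective f.rangeRestrict f.surjective_rangeRestrict hX
  have h := hmax _ (hT.2.2.2.2.comap_mkQ t (LinearMap.range f) ht hr)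
    (fun x hx => by
      simp only [Submodule.mem_comap, Submodule.mkQ_apply,
        (Submodule.Quotient.mk_eq_zero t).mpr hx, zero_mem])
  ext x
  obtain ⟨m, hm⟩ := t.mkQ_surjective (f x)
  have hmt : m ∈ t := by
    rw [← h, Submodule.mem_comap, hm]
    exact ⟨x, rfl⟩
  rw [← hm]
  exact (Submodule.Quotient.mk_eq_zero t).mpr hmt

section Wide

variable {W : Set (ModuleCat.{0} Λ)}

theorem IsWide.range_mem (hW : IsWide Λ W) {X Y : ModuleCat.{0} Λ} (f : X →ₗ[Λ] Y)
    (hX : X ∈ W) (hY : Y ∈ W) : ModuleCat.of Λ (LinearMap.range f) ∈ W := by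
  have h := hW.2.2.2.1 (M := Y) (N := ModuleCat.of Λ (Y ⧸ LinearMap.range f))
    (LinearMap.range f).mkQ hY (hW.2.2.2.2.1 f hX hY)
  exact hW.2.1.of_equiv (LinearEquiv.ofEq _ _ (Submodule.ker_mkQ _)) h

theorem IsWide.isTorsionClass_torsClosure (hW : IsWide Λ W) :
    IsTorsionClass Λ (torsClosure Λ W) :=
  BrickPaper.isTorsionClass_torsClosure hW.1

/-- A morphism from an object of `T(W)` to an object of `W` has its image in `W` and its kernel in
`T(W)`. -/
theorem IsWide.range_ker_mem (hW : IsWide Λ W) {X V : ModuleCat.{0} Λ}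
    (hX : X ∈ torsClosure Λ W) (hV : V ∈ W) (f : X →ₗ[Λ] V) :
    ModuleCat.of Λ (LinearMap.range f) ∈ W ∧
      ModuleCat.of Λ (LinearMap.ker f) ∈ torsClosure Λ W := by
  have hT := hW.isTorsionClass_torsClosure
  suffices h : IsTorsionClass Λ {X | FG Λ X ∧ ∀ V ∈ W, ∀ f : X →ₗ[Λ] V,
      ModuleCat.of Λ (LinearMap.range f) ∈ W ∧
        ModuleCat.of Λ (LinearMap.ker f) ∈ torsClosure Λ W} from
    (torsClosure_subset h (fun Y hY => ⟨hW.1 Y hY, fun V hV f => ⟨hW.range_mem f hY hV,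
      subset_torsClosure W (hW.2.2.2.1 f hY hV)⟩⟩) hX).2 V hV f
  have hquot : ∀ ⦃M N : ModuleCat.{0} Λ⦄ (g : M →ₗ[Λ] N), Function.Surjective g →
      (∀ V ∈ W, ∀ f : M →ₗ[Λ] V, ModuleCat.of Λ (LinearMap.range f) ∈ W ∧
        ModuleCat.of Λ (LinearMap.ker f) ∈ torsClosure Λ W) →
      (∀ V ∈ W, ∀ f : N →ₗ[Λ] V, ModuleCat.of Λ (LinearMap.range f) ∈ W ∧
        ModuleCat.of Λ (LinearMap.ker f) ∈ torsClosure Λ W) := by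
    intro M N g hg hM V hV f
    obtain ⟨h₁, h₂⟩ := hM V hV (f ∘ₗ g)
    refine ⟨hW.2.1.of_equiv (LinearEquiv.ofEq _ _ (LinearMap.range_comp_of_range_eq_top f
      (LinearMap.range_eq_top.mpr hg))) h₁, ?_⟩
    refine hT.2.2.2.1.of_surjective (g.restrict (p := LinearMap.ker (f ∘ₗ g))
      (q := LinearMap.ker f) fun x hx => hx) ?_ h₂
    rintro ⟨n, hn⟩
    obtain ⟨m, rfl⟩ := hg n
    exact ⟨⟨m, hn⟩, rfl⟩
  refine ⟨fun M hM => hM.1, ?_, ?_, ?_, ?_⟩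
  · rintro M N ⟨e⟩ hM
    exact ⟨isTorsionClass_fg.2.1 ⟨e⟩ hM.1, hquot e.toLinearMap e.surjective hM.2⟩
  · intro M hM
    have hM' : M ∈ W := hW.2.2.1 M hM
    exact ⟨hW.1 M hM', fun V hV f => ⟨hW.range_mem f hM' hV,
      subset_torsClosure W (hW.2.2.2.1 f hM' hV)⟩⟩
  · intro M N g hg hM
    exact ⟨isTorsionClass_fg.2.2.2.1 g hg hM.1, hquot g hg hM.2⟩
  · intro A M B f g hf hg hfg hA hB
    refine ⟨isTorsionClass_fg.2.2.2.2 f g hf hg hfg hA.1 hB.1, fun V hV h => ?_⟩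
    have hgf : ∀ a, g (f a) = 0 := fun a => LinearMap.mem_ker.mp (hfg ▸ ⟨a, rfl⟩)
    obtain ⟨hI₁, hK₁⟩ := hA.2 V hV (h ∘ₗ f)
    set I₁ := LinearMap.range (h ∘ₗ f)
    have hV₁ : ModuleCat.of Λ (V ⧸ I₁) ∈ W :=
      hW.2.2.2.2.1 (M := ModuleCat.of Λ I₁) (N := V) I₁.subtype hI₁ hV |> fun h =>
        hW.2.1.of_equiv (Submodule.quotEquivOfEq _ _ I₁.range_subtype) h
    obtain ⟨h₂, hh₂⟩ := exists_factor_of_surjective g hg (I₁.mkQ ∘ₗ h) (by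
      rw [← hfg]
      rintro _ ⟨a, rfl⟩
      exact (Submodule.Quotient.mk_eq_zero I₁).mpr ⟨a, rfl⟩)
    obtain ⟨hI₂, hK₂⟩ := hB.2 _ hV₁ h₂
    constructor
    · refine hW.2.1.of_equiv (LinearEquiv.ofEq _ _ ?_) (hW.2.2.2.2.2.comap_mkQ I₁ _ hI₁ hI₂)
      ext v
      constructor
      · rintro ⟨b, hb⟩
        obtain ⟨m, rfl⟩ := hg b
        rw [hh₂] at hb
        obtain ⟨a, ha⟩ := (Submodule.Quotient.eq I₁).mp hb.symm
        exact ⟨f a + m, by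
          rw [map_add]
          exact (congrArg (· + h m) ha).trans (sub_add_cancel _ _)⟩
      · rintro ⟨m, rfl⟩
        exact ⟨g m, hh₂ m⟩
    · refine hT.2.2.2.2 (A := ModuleCat.of Λ (LinearMap.ker (h ∘ₗ f)))
        (M := ModuleCat.of Λ (LinearMap.ker h)) (B := ModuleCat.of Λ (LinearMap.ker h₂))
        (f.restrict fun x hx => hx)
        (g.restrict fun x hx => by
          rw [LinearMap.mem_ker, hh₂, LinearMap.comp_apply, LinearMap.mem_ker.mp hx, map_zero])
        ?_ ?_ ?_ hK₁ hK₂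
      · rintro ⟨x, hx⟩ ⟨y, hy⟩ hxy
        exact Subtype.ext (hf (congrArg Subtype.val hxy))
      · rintro ⟨b, hb⟩
        obtain ⟨m, rfl⟩ := hg b
        rw [LinearMap.mem_ker, hh₂] at hb
        obtain ⟨a, ha⟩ := (Submodule.Quotient.mk_eq_zero I₁).mp hb
        have ha' : h (f a) = h m := ha
        refine ⟨⟨m - f a, by rw [LinearMap.mem_ker, map_sub, ha', sub_self]⟩, ?_⟩
        apply Subtype.ext
        change g (m - f a) = g m
        rw [map_sub, hgf, sub_zero]
      · ext ⟨m, hm⟩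
        constructor
        · rintro ⟨⟨a, ha⟩, haa⟩
          have haa' : f a = m := congrArg Subtype.val haa
          rw [LinearMap.mem_ker]
          apply Subtype.ext
          change g m = 0
          rw [← haa', hgf]
        · intro hk
          have hk' : g m = 0 := congrArg Subtype.val (LinearMap.mem_ker.mp hk)
          obtain ⟨a, rfl⟩ : m ∈ LinearMap.range f := hfg ▸ hk'
          exact ⟨⟨a, hm⟩, rfl⟩

/-- An object of `T(W)` which receives no nonzero morphism from `^⊥W` belongs to `W`. -/
theorem IsWide.mem_of_mem_torsClosure [IsArtinianRing Λ] (hW : IsWide Λ W) {X : ModuleCat.{0} Λ}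
    (hX : X ∈ torsClosure Λ W) (h : ∀ Y ∈ lPerp Λ W, ∀ f : Y →ₗ[Λ] X, f = 0) : X ∈ W := by
  have hT := hW.isTorsionClass_torsClosure
  have : Module.Finite Λ X := hT.1 X hX
  obtain ⟨N, hN, hmin⟩ := exists_minimal_submodule (Λ := Λ)
    (fun N : Submodule Λ X => ModuleCat.of Λ (X ⧸ N) ∈ W)
    ⟨⊤, hW.2.2.1 _ (inferInstanceAs (Subsingleton (X ⧸ (⊤ : Submodule Λ X))))⟩
  have hNT : ModuleCat.of Λ N ∈ torsClosure Λ W :=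
    hT.2.1.of_equiv (LinearEquiv.ofEq _ _ (Submodule.ker_mkQ N))
      (hW.range_ker_mem (V := ModuleCat.of Λ (X ⧸ N)) hX hN N.mkQ).2
  by_cases hNW : ModuleCat.of Λ N ∈ lPerp Λ W
  · have h0 : N.subtype = 0 := h _ hNW N.subtype
    have hbot : N = ⊥ := by rw [← N.range_subtype, h0, LinearMap.range_zero]
    subst hbot
    exact hW.2.1 ⟨Submodule.quotEquivOfEqBot (⊥ : Submodule Λ X) rfl⟩ hN
  · exfalso
    have : ∃ V ∈ W, ∃ f : N →ₗ[Λ] V, f ≠ 0 := by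
      by_contra! hcon
      exact hNW ⟨hT.1 _ hNT, hcon⟩
    obtain ⟨V, hV, f, hf⟩ := this
    have hr : ModuleCat.of Λ (LinearMap.range f) ∈ W :=
      (hW.range_ker_mem (X := ModuleCat.of Λ N) hNT hV f).1
    obtain ⟨P, hP⟩ : ∃ P : Submodule Λ X, P = (LinearMap.ker f).map N.subtype := ⟨_, rfl⟩
    have hPN : P ≤ N := hP ▸ Submodule.map_subtype_le N _
    have hPmem : ∀ x : N, (x : X) ∈ P ↔ f x = 0 := fun x => by simp [hP]
    have hmem : ModuleCat.of Λ (X ⧸ P) ∈ W := by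
      refine hW.2.2.2.2.2 (A := ModuleCat.of Λ (N ⧸ LinearMap.ker f))
        (M := ModuleCat.of Λ (X ⧸ P)) (B := ModuleCat.of Λ (X ⧸ N))
        ((LinearMap.ker f).mapQ P N.subtype fun x hx => (hPmem x).mpr hx)
        (Submodule.factor hPN) ?_ (Submodule.factor_surjective hPN) ?_
        (hW.2.1.of_equiv f.quotKerEquivRange.symm hr) hN
      · rw [← LinearMap.ker_eq_bot, LinearMap.ker_eq_bot']
        intro q hq
        obtain ⟨x, rfl⟩ := (LinearMap.ker f).mkQ_surjective q
        exact (Submodule.Quotient.mk_eq_zero _).mpr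
          ((hPmem x).mp ((Submodule.Quotient.mk_eq_zero P).mp hq))
      · ext q
        obtain ⟨x, rfl⟩ := P.mkQ_surjective q
        constructor
        · rintro ⟨y, hy⟩
          obtain ⟨y, rfl⟩ := (LinearMap.ker f).mkQ_surjective y
          rw [← hy]
          exact (Submodule.Quotient.mk_eq_zero N).mpr y.2
        · intro hx
          have hxN : x ∈ N := (Submodule.Quotient.mk_eq_zero N).mp hx
          exact ⟨(LinearMap.ker f).mkQ ⟨x, hxN⟩, rfl⟩
    have hPeq := hmin P hmem hPN
    apply hf
    ext x
    exact (hPmem x).mp (hPeq ▸ x.2)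

theorem IsWide.surjective_of_ne_zero (hW : IsWide Λ W) {s X : ModuleCat.{0} Λ}
    (hs : s ∈ simOf Λ W) (hX : X ∈ torsClosure Λ W) (f : X →ₗ[Λ] s) (hf : f ≠ 0) :
    Function.Surjective f := by
  have h := hs.2.2 (ModuleCat.of Λ (LinearMap.range f)) (LinearMap.range f).subtype
    (hW.range_ker_mem hX hs.1 f).1 (Submodule.injective_subtype _)
  rw [Submodule.range_subtype] at h
  rcases h with h | h
  · exact absurd (LinearMap.range_eq_bot.mp h) hf
  · exact LinearMap.range_eq_top.mp h

theorem IsWide.bijective_of_ne_zero (hW : IsWide Λ W) {s s' : ModuleCat.{0} Λ}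
    (hs : s ∈ simOf Λ W) (hs' : s' ∈ simOf Λ W) (f : s →ₗ[Λ] s') (hf : f ≠ 0) :
    Function.Bijective f := by
  refine ⟨?_, hW.surjective_of_ne_zero hs' (subset_torsClosure W hs.1) f hf⟩
  have h := hs.2.2 (ModuleCat.of Λ (LinearMap.ker f)) (LinearMap.ker f).subtype
    (hW.2.2.2.1 f hs.1 hs'.1) (Submodule.injective_subtype _)
  rw [Submodule.range_subtype] at h
  rcases h with h | h
  · exact LinearMap.ker_eq_bot.mp h
  · exact absurd (LinearMap.ker_eq_top.mp h) hf

theorem IsWide.mem_or_subset_lPerp (hW : IsWide Λ W) {s : ModuleCat.{0} Λ}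
    (hs : s ∈ simOf Λ W) {C : Set (ModuleCat.{0} Λ)} (hC : IsTorsionClass Λ C)
    (hCW : C ⊆ torsClosure Λ W) : s ∈ C ∨ C ⊆ lPerp Λ {s} := by
  by_contra! h
  obtain ⟨hsC, h⟩ := h
  apply h
  intro X hX
  refine ⟨hC.1 X hX, ?_⟩
  rintro Y rfl f
  by_contra hf
  exact hsC (hC.2.2.2.1 f (hW.surjective_of_ne_zero hs (hCW hX) f hf) hX)

theorem notMem_lPerp_self {s : ModuleCat.{0} Λ} [Nontrivial s] : s ∉ lPerp Λ {s} := by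
  intro h
  obtain ⟨x, hx⟩ := exists_ne (0 : s)
  exact hx (LinearMap.congr_fun (h.2 s rfl LinearMap.id) x)

/-- A nonzero object of a wide subcategory has a simple quotient in it. -/
theorem IsWide.exists_simple_quotient [IsArtinianRing Λ] (hW : IsWide Λ W)
    {V : Type} [AddCommGroup V] [Module Λ V] [Nontrivial V] (hV : ModuleCat.of Λ V ∈ W) :
    ∃ N : Submodule Λ V, N ≠ ⊤ ∧ ModuleCat.of Λ N ∈ W ∧ ModuleCat.of Λ (V ⧸ N) ∈ simOf Λ W := by
  have : Module.Finite Λ V := hW.1 _ hV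
  obtain ⟨N, ⟨hNtop, hN⟩, hmax⟩ := exists_maximal_submodule (Λ := Λ)
    (fun N : Submodule Λ V => N ≠ ⊤ ∧ ModuleCat.of Λ N ∈ W)
    ⟨⊥, bot_ne_top, hW.2.2.1 _ (inferInstanceAs (Subsingleton (⊥ : Submodule Λ V)))⟩
  refine ⟨N, hNtop, hN, ?_, Submodule.Quotient.nontrivial_iff.mpr hNtop, fun X f hX hf => ?_⟩
  · exact hW.2.1.of_equiv (Submodule.quotEquivOfEq _ _ N.range_subtype)
      (hW.2.2.2.2.1 (M := ModuleCat.of Λ N) (N := ModuleCat.of Λ V) N.subtype hN hV)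
  · set R : Submodule Λ (V ⧸ N) := LinearMap.range f
    have hRW : ModuleCat.of Λ R ∈ W :=
      hW.2.1.of_equiv (X := X) (LinearEquiv.ofInjective f hf) hX
    have hle : N ≤ R.comap N.mkQ := fun x hx => by
      simp [(Submodule.Quotient.mk_eq_zero N).mpr hx]
    by_cases hRtop : R = ⊤
    · exact Or.inr hRtop
    · left
      have hne : R.comap N.mkQ ≠ ⊤ := fun h => hRtop (by
        rw [eq_top_iff]
        rintro q -
        obtain ⟨x, rfl⟩ := N.mkQ_surjective q
        exact Submodule.mem_comap.mp (h ▸ Submodule.mem_top))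
      have heq := hmax _ ⟨hne, hW.2.2.2.2.2.comap_mkQ N R hN hRW⟩ hle
      change R = ⊥
      rw [eq_bot_iff]
      intro q hq
      obtain ⟨x, rfl⟩ := N.mkQ_surjective q
      have hx : x ∈ N := heq ▸ hq
      exact (Submodule.Quotient.mk_eq_zero N).mpr hx

theorem IsWide.torsClosure_simOf [IsArtinianRing Λ] (hW : IsWide Λ W) :
    torsClosure Λ (simOf Λ W) = torsClosure Λ W := by
  have hS : IsTorsionClass Λ (torsClosure Λ (simOf Λ W)) :=
    BrickPaper.isTorsionClass_torsClosure fun M hM => hW.1 M hM.1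
  apply subset_antisymm
  · exact torsClosure_subset hW.isTorsionClass_torsClosure
      fun M hM => subset_torsClosure W hM.1
  refine torsClosure_subset hS fun V hV => ?_
  have : Module.Finite Λ V := hW.1 V hV
  obtain ⟨N, ⟨hNW, hNS⟩, hmin⟩ := exists_minimal_submodule (Λ := Λ)
    (fun N : Submodule Λ V => ModuleCat.of Λ N ∈ W ∧
      ModuleCat.of Λ (V ⧸ N) ∈ torsClosure Λ (simOf Λ W))
    ⟨⊤, hW.2.1.of_equiv Submodule.topEquiv.symm hV,
      hS.2.2.1 _ (inferInstanceAs (Subsingleton (V ⧸ (⊤ : Submodule Λ V))))⟩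
  rcases subsingleton_or_nontrivial N with hsub | hnt
  · have hbot : N = ⊥ := Submodule.subsingleton_iff_eq_bot.mp hsub
    subst hbot
    exact hS.2.1 ⟨Submodule.quotEquivOfEqBot (⊥ : Submodule Λ V) rfl⟩ hNS
  · exfalso
    obtain ⟨P, hPtop, hPW, hPsim⟩ := hW.exists_simple_quotient hNW
    obtain ⟨Q, hQ⟩ : ∃ Q : Submodule Λ V, Q = P.map N.subtype := ⟨_, rfl⟩
    have hQN : Q ≤ N := hQ ▸ Submodule.map_subtype_le N _
    have hQmem : ∀ x : N, (x : V) ∈ Q ↔ x ∈ P := fun x => by simp [hQ]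
    have hQS : ModuleCat.of Λ (V ⧸ Q) ∈ torsClosure Λ (simOf Λ W) := by
      refine hS.2.2.2.2 (A := ModuleCat.of Λ (N ⧸ P))
        (M := ModuleCat.of Λ (V ⧸ Q)) (B := ModuleCat.of Λ (V ⧸ N))
        (P.mapQ Q N.subtype fun x hx => (hQmem x).mpr hx)
        (Submodule.factor hQN) ?_ (Submodule.factor_surjective hQN) ?_
        (subset_torsClosure _ hPsim) hNS
      · rw [← LinearMap.ker_eq_bot, LinearMap.ker_eq_bot']
        intro q hq
        obtain ⟨x, rfl⟩ := P.mkQ_surjective q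
        exact (Submodule.Quotient.mk_eq_zero _).mpr
          ((hQmem x).mp ((Submodule.Quotient.mk_eq_zero Q).mp hq))
      · ext q
        obtain ⟨x, rfl⟩ := Q.mkQ_surjective q
        constructor
        · rintro ⟨y, hy⟩
          obtain ⟨y, rfl⟩ := P.mkQ_surjective y
          rw [← hy]
          exact (Submodule.Quotient.mk_eq_zero N).mpr y.2
        · intro hx
          have hxN : x ∈ N := (Submodule.Quotient.mk_eq_zero N).mp hx
          exact ⟨P.mkQ ⟨x, hxN⟩, rfl⟩
    have hQW : ModuleCat.of Λ Q ∈ W :=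
      hQ ▸ hW.2.1.of_equiv (Submodule.equivMapOfInjective N.subtype N.injective_subtype P) hPW
    have hQeq := hmin Q ⟨hQW, hQS⟩ hQN
    apply hPtop
    rw [eq_top_iff]
    rintro x -
    exact (hQmem x).mp (hQeq ▸ x.2)

theorem IsWide.lPerp_simOf [IsArtinianRing Λ] (hW : IsWide Λ W) :
    lPerp Λ (simOf Λ W) = lPerp Λ W := by
  apply subset_antisymm
  · intro X hX
    refine ⟨hX.1, fun V hV f => ?_⟩
    have : Module.Finite Λ V := hW.1 V hV
    obtain ⟨N, ⟨hNW, hfN⟩, hmin⟩ := exists_minimal_submodule (Λ := Λ)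
      (fun N : Submodule Λ V => ModuleCat.of Λ N ∈ W ∧ ∀ x, f x ∈ N)
      ⟨⊤, hW.2.1.of_equiv Submodule.topEquiv.symm hV, fun _ => Submodule.mem_top⟩
    rcases subsingleton_or_nontrivial N with hsub | hnt
    · ext x
      exact congrArg Subtype.val (Subsingleton.elim (⟨f x, hfN x⟩ : N) 0)
    · exfalso
      obtain ⟨P, hPtop, hPW, hPsim⟩ := hW.exists_simple_quotient hNW
      have h0 := hX.2 _ hPsim (P.mkQ ∘ₗ f.codRestrict N hfN)
      have hQ : ∀ x, f x ∈ P.map N.subtype := fun x =>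
        ⟨⟨f x, hfN x⟩, (Submodule.Quotient.mk_eq_zero P).mp (LinearMap.congr_fun h0 x), rfl⟩
      have hQeq := hmin (P.map N.subtype) ⟨hW.2.1.of_equiv
        (Submodule.equivMapOfInjective N.subtype N.injective_subtype P) hPW, hQ⟩
        (Submodule.map_subtype_le N _)
      apply hPtop
      rw [eq_top_iff]
      rintro x -
      obtain ⟨y, hy, hyx⟩ : (x : V) ∈ P.map N.subtype := hQeq.symm.le x.2
      rwa [← (Subtype.ext hyx : y = x)]
  · exact fun X hX => ⟨hX.1, fun V hV => hX.2 V hV.1⟩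

/-- The torsion classes generated by single simple objects of `W`. -/
def simTors (W : Set (ModuleCat.{0} Λ)) : Set (Set (ModuleCat.{0} Λ)) :=
  {a | ∃ s ∈ simOf Λ W, a = torsClosure Λ {s}}

theorem IsWide.isTorsionClass_simple (hW : IsWide Λ W) {s : ModuleCat.{0} Λ}
    (hs : s ∈ simOf Λ W) : IsTorsionClass Λ (torsClosure Λ {s}) :=
  BrickPaper.isTorsionClass_torsClosure (by rintro M rfl; exact hW.1 M hs.1)

theorem IsWide.torsClosure_simple_subset (hW : IsWide Λ W) {s : ModuleCat.{0} Λ}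
    (hs : s ∈ simOf Λ W) : torsClosure Λ {s} ⊆ torsClosure Λ W :=
  torsClosure_subset hW.isTorsionClass_torsClosure
    (by rintro M rfl; exact subset_torsClosure W hs.1)

theorem mem_torsClosure_self (s : ModuleCat.{0} Λ) : s ∈ torsClosure Λ {s} :=
  subset_torsClosure _ rfl

theorem torsClosure_singleton_subset {s : ModuleCat.{0} Λ} {C : Set (ModuleCat.{0} Λ)}
    (hC : IsTorsionClass Λ C) (h : s ∈ C) : torsClosure Λ {s} ⊆ C :=
  torsClosure_subset hC (by rintro M rfl; exact h)

theorem IsWide.exists_mem_of_mem_torsJoin (hW : IsWide Λ W) {s : ModuleCat.{0} Λ}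
    (hs : s ∈ simOf Λ W) {B : Set (Set (ModuleCat.{0} Λ))} (hB : ∀ b ∈ B, IsTorsionClass Λ b)
    (hBW : ∀ b ∈ B, b ⊆ torsClosure Λ W) (h : s ∈ torsJoin Λ B) : ∃ b ∈ B, s ∈ b := by
  by_contra! hcon
  have := hs.2.1
  exact notMem_lPerp_self (torsJoin_subset (isTorsionClass_lPerp {s}) (fun b hb =>
    (hW.mem_or_subset_lPerp hs (hB b hb) (hBW b hb)).resolve_left (hcon b hb)) h)

theorem IsWide.isCJR_simTors [IsArtinianRing Λ] (hW : IsWide Λ W) :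
    IsCJR Λ (torsClosure Λ W) (simTors W) := by
  have hA : ∀ a ∈ simTors W, IsTorsionClass Λ a := by
    rintro _ ⟨s, hs, rfl⟩
    exact hW.isTorsionClass_simple hs
  refine ⟨⟨hA, ?_⟩, ?_, ?_⟩
  · apply subset_antisymm
    · refine torsJoin_subset hW.isTorsionClass_torsClosure ?_
      rintro _ ⟨s, hs, rfl⟩
      exact hW.torsClosure_simple_subset hs
    · rw [← hW.torsClosure_simOf]
      exact torsClosure_subset (isTorsionClass_torsJoin hA) fun s hs =>
        subset_torsJoin (show torsClosure Λ {s} ∈ simTors W from ⟨s, hs, rfl⟩)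
          (mem_torsClosure_self s)
  · rintro B ⟨hB, hBW⟩ _ ⟨s, hs, rfl⟩
    obtain ⟨b, hb, hsb⟩ := hW.exists_mem_of_mem_torsJoin hs hB
      (fun b hb => hBW ▸ subset_torsJoin hb) (hBW ▸ subset_torsClosure W hs.1)
    exact ⟨b, hb, torsClosure_singleton_subset (hB b hb) hsb⟩
  · rintro _ ⟨s, hs, rfl⟩ _ ⟨s', hs', rfl⟩ hle
    refine subset_antisymm hle (torsClosure_singleton_subset (hW.isTorsionClass_simple hs) ?_)
    have := hs.2.1
    have hne : ∃ f : s' →ₗ[Λ] s, f ≠ 0 := by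
      by_contra! hcon
      refine notMem_lPerp_self (torsClosure_singleton_subset (isTorsionClass_lPerp {s})
        (s := s') ⟨hW.1 s' hs'.1, ?_⟩ (hle (mem_torsClosure_self s)))
      rintro Y rfl f
      exact hcon f
    obtain ⟨f, hf⟩ := hne
    have hbij := hW.bijective_of_ne_zero hs' hs f hf
    exact (hW.isTorsionClass_simple hs).2.1 ⟨(LinearEquiv.ofBijective f hbij).symm⟩
      (mem_torsClosure_self s)

theorem IsWide.completelyJoinIrred_simple (hW : IsWide Λ W) {s : ModuleCat.{0} Λ}
    (hs : s ∈ simOf Λ W) : CompletelyJoinIrred Λ (torsClosure Λ {s}) := by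
  refine ⟨hW.isTorsionClass_simple hs, fun X hX hXs => ?_⟩
  have hle : ∀ a ∈ X, a ⊆ torsClosure Λ {s} := fun a ha => hXs ▸ subset_torsJoin ha
  obtain ⟨a, ha, hsa⟩ := hW.exists_mem_of_mem_torsJoin hs hX
    (fun a ha => (hle a ha).trans (hW.torsClosure_simple_subset hs))
    (hXs ▸ mem_torsClosure_self s)
  rwa [subset_antisymm (torsClosure_singleton_subset (hX a ha) hsa) (hle a ha)]

theorem IsWide.jstar_simple (hW : IsWide Λ W) {s : ModuleCat.{0} Λ} (hs : s ∈ simOf Λ W) :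
    jstar Λ (torsClosure Λ {s}) = torsClosure Λ {s} ∩ lPerp Λ {s} := by
  have hT := (hW.isTorsionClass_simple hs).inter (isTorsionClass_lPerp {s})
  have := hs.2.1
  apply subset_antisymm
  · refine torsJoin_subset hT fun C hC => Set.subset_inter hC.2.1 ?_
    refine (hW.mem_or_subset_lPerp hs hC.1
      (hC.2.1.trans (hW.torsClosure_simple_subset hs))).resolve_left fun hsC => ?_
    exact hC.2.2 (torsClosure_singleton_subset hC.1 hsC)
  · exact subset_torsJoin ⟨hT, Set.inter_subset_left,
      fun h => notMem_lPerp_self (h (mem_torsClosure_self s)).2⟩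

theorem IsWide.isKappa_simple (hW : IsWide Λ W) {s : ModuleCat.{0} Λ} (hs : s ∈ simOf Λ W) :
    IsKappa Λ (torsClosure Λ {s}) (lPerp Λ {s}) := by
  have hT := hW.isTorsionClass_simple hs
  refine ⟨isTorsionClass_lPerp {s}, (hW.jstar_simple hs).symm, fun C hC h X hX => ?_⟩
  rw [hW.jstar_simple hs] at h
  refine ⟨hC.1 X hX, ?_⟩
  rintro Y rfl f
  by_contra hf
  set I : Submodule Λ Y := LinearMap.range f
  have hIC : ModuleCat.of Λ I ∈ C :=
    hC.2.2.2.1.of_surjective (X := X) f.rangeRestrict f.surjective_rangeRestrict hX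
  have hQT : ModuleCat.of Λ (Y ⧸ I) ∈ torsClosure Λ {Y} :=
    hT.2.2.2.1.of_surjective (X := Y) I.mkQ I.mkQ_surjective (mem_torsClosure_self Y)
  have hQp : ModuleCat.of Λ (Y ⧸ I) ∈ lPerp Λ {Y} := by
    refine ⟨hT.1 _ hQT, ?_⟩
    rintro Z rfl g
    by_contra hg
    have hgne : g ∘ₗ I.mkQ ≠ 0 := fun h0 => hg (by
      ext y
      exact LinearMap.congr_fun h0 y)
    have hinj := (hW.bijective_of_ne_zero hs hs (g ∘ₗ I.mkQ) hgne).1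
    apply hf
    ext x
    apply hinj
    have hx : I.mkQ (f x) = 0 := (Submodule.Quotient.mk_eq_zero I).mpr ⟨x, rfl⟩
    simp [hx]
  have hQC : ModuleCat.of Λ (Y ⧸ I) ∈ C := (h.symm ▸ (⟨hQT, hQp⟩ :
    ModuleCat.of Λ (Y ⧸ I) ∈ torsClosure Λ {Y} ∩ lPerp Λ {Y}) :
      ModuleCat.of Λ (Y ⧸ I) ∈ torsClosure Λ {Y} ∩ C).2
  have hYC : Y ∈ C := hC.2.2.2.2.of_submodule I hIC hQC
  have hY : Y ∈ torsClosure Λ {Y} ∩ lPerp Λ {Y} := h ▸ ⟨mem_torsClosure_self Y, hYC⟩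
  have := hs.2.1
  exact notMem_lPerp_self hY.2

theorem IsKappa.unique {J k k' : Set (ModuleCat.{0} Λ)} (h : IsKappa Λ J k)
    (h' : IsKappa Λ J k') : k = k' :=
  subset_antisymm (h'.2.2 k h.1 h.2.1) (h.2.2 k' h'.1 h'.2.1)

theorem IsCJR.unique {T : Set (ModuleCat.{0} Λ)} {A B : Set (Set (ModuleCat.{0} Λ))}
    (hA : IsCJR Λ T A) (hB : IsCJR Λ T B) : A = B := by
  have key : ∀ {A B : Set (Set (ModuleCat.{0} Λ))}, IsCJR Λ T A → IsCJR Λ T B → A ⊆ B := by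
    intro A B hA hB a ha
    obtain ⟨b, hb, hab⟩ := hA.2.1 B hB.1 a ha
    obtain ⟨a', ha', hba'⟩ := hB.2.1 A hA.1 b hb
    have haa' := hA.2.2 a ha a' ha' (hab.trans hba')
    rwa [subset_antisymm hab (haa' ▸ hba')]
  exact subset_antisymm (key hA hB) (key hB hA)

/-- The extended kappa map sends `T(W)` to `^⊥W`. -/
theorem IsWide.isKappaBar_iff [IsArtinianRing Λ] (hW : IsWide Λ W) (k : Set (ModuleCat.{0} Λ)) :
    IsKappaBar Λ (torsClosure Λ W) k ↔ k = lPerp Λ W := by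
  have hmeet : torsMeet Λ {k | ∃ j ∈ simTors W, IsKappa Λ j k} = lPerp Λ W := by
    rw [← hW.lPerp_simOf]
    apply subset_antisymm
    · rintro X ⟨hX, hXk⟩
      exact ⟨hX, fun s hs f =>
        (hXk _ ⟨_, ⟨s, hs, rfl⟩, hW.isKappa_simple hs⟩ : X ∈ lPerp Λ {s}).2 s rfl f⟩
    · intro X hX
      refine ⟨hX.1, ?_⟩
      rintro k ⟨_, ⟨s, hs, rfl⟩, hk⟩
      rw [hk.unique (hW.isKappa_simple hs)]
      refine ⟨hX.1, ?_⟩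
      rintro Y rfl f
      exact hX.2 Y hs f
  constructor
  · rintro ⟨A, hA, -, -, rfl⟩
    rw [hA.unique hW.isCJR_simTors, hmeet]
  · rintro rfl
    refine ⟨_, hW.isCJR_simTors, ?_, ?_, hmeet.symm⟩
    · rintro _ ⟨s, hs, rfl⟩
      exact hW.completelyJoinIrred_simple hs
    · rintro _ ⟨s, hs, rfl⟩
      exact ⟨_, hW.isKappa_simple hs⟩

theorem IsWide.subset_iff_kappaLE [IsArtinianRing Λ] {W₁ W₂ : Set (ModuleCat.{0} Λ)}
    (h₁ : IsWide Λ W₁) (h₂ : IsWide Λ W₂) :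
    W₁ ⊆ W₂ ↔ KappaLE Λ (torsClosure Λ W₁) (torsClosure Λ W₂) := by
  constructor
  · intro h
    refine ⟨torsClosure_subset h₂.isTorsionClass_torsClosure (h.trans (subset_torsClosure _)), ?_⟩
    intro K₁ K₂ hK₁ hK₂
    rw [(h₁.isKappaBar_iff K₁).mp hK₁, (h₂.isKappaBar_iff K₂).mp hK₂]
    exact fun X hX => ⟨hX.1, fun V hV => hX.2 V (h hV)⟩
  · rintro ⟨hT, hK⟩ X hX
    have hperp := hK _ _ ((h₁.isKappaBar_iff _).mpr rfl) ((h₂.isKappaBar_iff _).mpr rfl)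
    exact h₂.mem_of_mem_torsClosure (hT (subset_torsClosure _ hX))
      fun Y hY f => (hperp hY).2 X hX f

theorem IsWide.torsClosure_injective [IsArtinianRing Λ] {W₁ W₂ : Set (ModuleCat.{0} Λ)}
    (h₁ : IsWide Λ W₁) (h₂ : IsWide Λ W₂) (h : torsClosure Λ W₁ = torsClosure Λ W₂) :
    W₁ = W₂ := by
  have hperp : lPerp Λ W₁ = lPerp Λ W₂ :=
    (h₂.isKappaBar_iff _).mp (h ▸ (h₁.isKappaBar_iff _).mpr rfl)
  apply subset_antisymm
  · exact fun X hX => h₂.mem_of_mem_torsClosure (h ▸ subset_torsClosure _ hX)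
      fun Y hY f => (hperp.symm ▸ hY : Y ∈ lPerp Λ W₁).2 X hX f
  · exact fun X hX => h₁.mem_of_mem_torsClosure (h ▸ subset_torsClosure _ hX)
      fun Y hY f => (hperp ▸ hY : Y ∈ lPerp Λ W₂).2 X hX f

end Wide

/-- Ingalls–Thomas: `α(T)` is a wide subcategory. -/
theorem IsTorsionClass.isWide_alphaOf {T : Set (ModuleCat.{0} Λ)} (hT : IsTorsionClass Λ T) :
    IsWide Λ (alphaOf Λ T) := by
  have hiso : IsoClosed Λ (alphaOf Λ T) := by
    rintro M N ⟨e⟩ hM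
    refine ⟨hT.2.1 ⟨e⟩ hM.1, fun Y g hY => ?_⟩
    exact hT.2.1.of_equiv (LinearEquiv.ofEq _ _ (LinearEquiv.ker_comp e.symm g))
      (hM.2 Y (e.symm.toLinearMap ∘ₗ g) hY)
  refine ⟨fun M hM => hT.1 M hM.1, hiso, ?_, ?_, ?_, ?_⟩
  · intro M hM
    refine ⟨hT.2.2.1 M hM, fun Y g hY => ?_⟩
    have hg : g = 0 := Subsingleton.elim _ _
    subst hg
    exact hT.2.1.of_equiv (X := Y) (Submodule.topEquiv.symm.trans
      (LinearEquiv.ofEq _ _ LinearMap.ker_zero.symm)) hY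
  · intro M N f hM hN
    refine ⟨hN.2 M f hM.1, fun Y g hY => ?_⟩
    have h := hM.2 Y ((LinearMap.ker f).subtype ∘ₗ g) hY
    exact hT.2.1.of_equiv (LinearEquiv.ofEq _ _
      (LinearMap.ker_comp_of_ker_eq_bot g (Submodule.ker_subtype _))) h
  · intro M N f hM hN
    refine ⟨hT.2.2.2.1.of_surjective (X := N) _ (Submodule.mkQ_surjective _) hN.1,
      fun Y (g : Y →ₗ[Λ] N ⧸ LinearMap.range f) hY => ?_⟩
    let I := LinearMap.range f
    set P : Submodule Λ (Y × N) :=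
      LinearMap.ker (g ∘ₗ LinearMap.fst Λ Y N - I.mkQ ∘ₗ LinearMap.snd Λ Y N) with hP
    have hPmem : ∀ y n, (y, n) ∈ P ↔ g y = I.mkQ n := fun y n => by
      rw [hP, LinearMap.mem_ker, LinearMap.sub_apply, sub_eq_zero]
      rfl
    have hPT : ModuleCat.of Λ P ∈ T := by
      refine hT.2.2.2.2 (A := ModuleCat.of Λ I) (M := ModuleCat.of Λ P) (B := Y)
        ((LinearMap.inr Λ Y N ∘ₗ I.subtype).codRestrict P fun x => (hPmem _ _).mpr
          ((map_zero g).trans ((Submodule.Quotient.mk_eq_zero I).mpr x.2).symm))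
        (LinearMap.fst Λ Y N ∘ₗ P.subtype) ?_ ?_ ?_
        (hT.2.2.2.1.of_surjective (X := M) f.rangeRestrict f.surjective_rangeRestrict hM.1) hY
      · intro x y hxy
        exact Subtype.ext (congrArg (fun p : P => p.1.2) hxy)
      · intro y
        obtain ⟨n, hn⟩ := I.mkQ_surjective (g y)
        exact ⟨⟨(y, n), (hPmem y n).mpr hn.symm⟩, rfl⟩
      · ext ⟨⟨y, n⟩, hyn⟩
        constructor
        · rintro ⟨x, hx⟩
          exact (congrArg (fun p : P => p.1.1) hx).symm
        · intro hy
          have hy' : y = 0 := hy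
          subst hy'
          have hn : n ∈ I := (Submodule.Quotient.mk_eq_zero I).mp
            (((hPmem _ _).mp hyn).symm.trans (map_zero g))
          exact ⟨⟨n, hn⟩, rfl⟩
    have hker := hN.2 (ModuleCat.of Λ P) (LinearMap.snd Λ Y N ∘ₗ P.subtype) hPT
    refine hT.2.2.2.1.of_surjective ((LinearMap.fst Λ Y N ∘ₗ P.subtype).restrict
      (p := LinearMap.ker (LinearMap.snd Λ Y N ∘ₗ P.subtype)) (q := LinearMap.ker g) ?_) ?_ hker
    · rintro ⟨⟨y, n⟩, hyn⟩ hn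
      have hn' : n = 0 := hn
      subst hn'
      exact ((hPmem _ _).mp hyn).trans (map_zero _)
    · rintro ⟨y, hy⟩
      exact ⟨⟨⟨(y, 0), (hPmem _ _).mpr ((LinearMap.mem_ker.mp hy).trans (map_zero _).symm)⟩, rfl⟩,
        rfl⟩
  · intro A M B f g hf hg hfg hA hB
    refine ⟨hT.2.2.2.2 f g hf hg hfg hA.1 hB.1, fun Y h hY => ?_⟩
    have h₁ := hB.2 Y (g ∘ₗ h) hY
    let e := LinearEquiv.ofInjective f hf
    have hmem : ∀ y : LinearMap.ker (g ∘ₗ h), h y ∈ LinearMap.range f := fun y => hfg ▸ y.2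
    set k : LinearMap.ker (g ∘ₗ h) →ₗ[Λ] LinearMap.range f :=
      (h ∘ₗ (LinearMap.ker (g ∘ₗ h)).subtype).codRestrict _ hmem
    have h₂ := hA.2 (ModuleCat.of Λ (LinearMap.ker (g ∘ₗ h))) (e.symm.toLinearMap ∘ₗ k) h₁
    have hker : ∀ y, y ∈ LinearMap.ker (e.symm.toLinearMap ∘ₗ k) ↔ h y = 0 := fun y => by
      rw [LinearMap.mem_ker, LinearMap.comp_apply, LinearEquiv.coe_coe,
        LinearEquiv.map_eq_zero_iff]
      exact Subtype.ext_iff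
    refine hT.2.2.2.1.of_surjective ((LinearMap.ker (g ∘ₗ h)).subtype.restrict
      (p := LinearMap.ker (e.symm.toLinearMap ∘ₗ k)) (q := LinearMap.ker h)
      fun y hy => (hker y).mp hy) ?_ h₂
    rintro ⟨y, hy⟩
    have hy' : h y = 0 := hy
    have hgy : y ∈ LinearMap.ker (g ∘ₗ h) := by
      rw [LinearMap.mem_ker, LinearMap.comp_apply, hy', map_zero]
    exact ⟨⟨⟨y, hgy⟩, (hker ⟨y, hgy⟩).mpr hy'⟩, rfl⟩

/-- If `a` is a member of the canonical join representation of `T`, there is a largest torsion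
class contained in `T` and not containing `a`; it contains the other members. -/
theorem IsCJR.exists_largest_not_containing {T : Set (ModuleCat.{0} Λ)}
    {A : Set (Set (ModuleCat.{0} Λ))} (hT : IsTorsionClass Λ T) (hA : IsCJR Λ T A)
    {a : Set (ModuleCat.{0} Λ)} (ha : a ∈ A) :
    ∃ J, IsTorsionClass Λ J ∧ J ⊆ T ∧ ¬ a ⊆ J ∧ (∀ b ∈ A, b ≠ a → b ⊆ J) ∧
      ∀ C, IsTorsionClass Λ C → C ⊆ T → ¬ a ⊆ C → C ⊆ J := by
  obtain ⟨⟨hAt, hAT⟩, href, hanti⟩ := hA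
  let B : Set (Set (ModuleCat.{0} Λ)) := {C | IsTorsionClass Λ C ∧ C ⊆ T ∧ ¬ a ⊆ C}
  have hB : ∀ b ∈ B, IsTorsionClass Λ b := fun b hb => hb.1
  have hJ := isTorsionClass_torsJoin hB
  have hJT : torsJoin Λ B ⊆ T := torsJoin_subset hT fun b hb => hb.2.1
  have hothers : ∀ b ∈ A, b ≠ a → b ⊆ torsJoin Λ B := fun b hb hne =>
    subset_torsJoin ⟨hAt b hb, hAT ▸ subset_torsJoin hb,
      fun hab => hne (hanti a ha b hb hab).symm⟩
  refine ⟨torsJoin Λ B, hJ, hJT, fun haJ => ?_, hothers,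
    fun C hC hCT haC => subset_torsJoin ⟨hC, hCT, haC⟩⟩
  have heq : torsJoin Λ B = T := by
    refine subset_antisymm hJT ?_
    rw [← hAT]
    refine torsJoin_subset hJ fun b hb => ?_
    by_cases hne : b = a
    · exact hne ▸ haJ
    · exact hothers b hb hne
  obtain ⟨C, hC, haC⟩ := href B ⟨hB, heq⟩ a ha
  exact hC.2.2 haC

theorem IsCJR.subset_torsClosure_alphaOf [IsArtinianRing Λ] {T : Set (ModuleCat.{0} Λ)}
    {A : Set (Set (ModuleCat.{0} Λ))} (hT : IsTorsionClass Λ T) (hA : IsCJR Λ T A)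
    {a : Set (ModuleCat.{0} Λ)} (ha : a ∈ A) : a ⊆ torsClosure Λ (alphaOf Λ T) := by
  obtain ⟨J, hJ, hJT, haJ, hothers, hmax⟩ := hA.exists_largest_not_containing hT ha
  have haT : a ⊆ T := hA.1.2 ▸ subset_torsJoin ha
  obtain ⟨X, hXa, hXJ⟩ := Set.not_subset.mp haJ
  have : Module.Finite Λ X := hT.1 X (haT hXa)
  obtain ⟨t, ht, htJ⟩ := hJ.exists_torsion_part X
  have htT : ModuleCat.of Λ (X ⧸ t) ∈ T :=
    hT.2.2.2.1.of_surjective (X := X) t.mkQ t.mkQ_surjective (haT hXa)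
  have htnt : (⊤ : Submodule Λ (X ⧸ t)) ≠ ⊥ := fun h => by
    have hsub : Subsingleton (X ⧸ t) := (Submodule.subsingleton_iff Λ).mp
      (subsingleton_of_bot_eq_top h.symm)
    exact hXJ (hJ.2.2.2.2.of_submodule (X := X) t ht (hJ.2.2.1 _ hsub))
  -- a minimal nonzero submodule of `X ⧸ t` lying in `T`
  obtain ⟨M, ⟨hM0, hMT⟩, hmin⟩ := exists_minimal_submodule (Λ := Λ)
    (fun N : Submodule Λ (X ⧸ t) => N ≠ ⊥ ∧ ModuleCat.of Λ N ∈ T)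
    ⟨⊤, htnt, hT.2.1.of_equiv Submodule.topEquiv.symm htT⟩
  have hMJ : ∀ Y ∈ J, ∀ f : Y →ₗ[Λ] M, f = 0 := fun Y hY f => by
    have h0 := htJ.2 Y hY (M.subtype ∘ₗ f)
    ext y
    exact LinearMap.congr_fun h0 y
  have hMnt : Nontrivial M := Submodule.nontrivial_iff_ne_bot.mpr hM0
  have hMnotJ : ModuleCat.of Λ M ∉ J := fun h => by
    obtain ⟨x, hx⟩ := exists_ne (0 : M)
    exact hx (LinearMap.congr_fun (hMJ _ h LinearMap.id) x)
  have hMfg : Module.Finite Λ M := hT.1 _ hMT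
  have hTM : IsTorsionClass Λ (torsClosure Λ {ModuleCat.of Λ M}) :=
    isTorsionClass_torsClosure (by rintro _ rfl; exact hMfg)
  have haM : a ⊆ torsClosure Λ {ModuleCat.of Λ M} := by
    by_contra h
    exact hMnotJ (hmax _ hTM (torsClosure_singleton_subset hT hMT) h (mem_torsClosure_self _))
  have hsurj : ∀ Y ∈ T, ∀ f : Y →ₗ[Λ] M, f ≠ 0 → Function.Surjective f := fun Y hY f hf => by
    have hr : ModuleCat.of Λ (LinearMap.range (M.subtype ∘ₗ f)) ∈ T :=
      hT.2.2.2.1.of_surjective (X := Y) _ (LinearMap.surjective_rangeRestrict _) hY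
    have heq := hmin _ ⟨fun h => hf (by
      ext y
      exact LinearMap.congr_fun (LinearMap.range_eq_bot.mp h) y), hr⟩
      (by rintro _ ⟨y, rfl⟩; exact (f y).2)
    intro m
    obtain ⟨y, hy⟩ : (m : X ⧸ t) ∈ LinearMap.range (M.subtype ∘ₗ f) := heq.symm ▸ m.2
    exact ⟨y, Subtype.ext hy⟩
  -- `T` is the join of `J` and the torsion class generated by `M`
  have hgen : ∀ C, IsTorsionClass Λ C → J ⊆ C → ModuleCat.of Λ M ∈ C → T ⊆ C := by
    intro C hC hJC hMC
    rw [← hA.1.2]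
    refine torsJoin_subset hC fun b hb => ?_
    by_cases hne : b = a
    · exact hne ▸ haM.trans (torsClosure_singleton_subset hC hMC)
    · exact (hothers b hb hne).trans hJC
  have hsplit : ∀ (Y : Type) [AddCommGroup Y] [Module Λ Y], ModuleCat.of Λ Y ∈ T →
      ∀ g : Y →ₗ[Λ] M, Function.Surjective g →
        ModuleCat.of Λ (LinearMap.ker g) ∈ rPerp Λ T → LinearMap.ker g = ⊥ := by
    intro Y _ _ hY g hg hker
    have hkerT : ∀ Z ∈ T, ∀ f : Z →ₗ[Λ] Y, (∀ z, g (f z) = 0) → f = 0 := by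
      intro Z hZ f hf
      have h0 := hker.2 Z hZ (f.codRestrict (LinearMap.ker g) hf)
      ext z
      exact congrArg Subtype.val (LinearMap.congr_fun h0 z)
    have hYJ : ∀ Z ∈ J, ∀ f : Z →ₗ[Λ] Y, f = 0 := fun Z hZ f =>
      hkerT Z (hJT hZ) f fun z => LinearMap.congr_fun (hMJ Z hZ (g ∘ₗ f)) z
    have hne : ∃ f : M →ₗ[Λ] Y, f ≠ 0 := by
      by_contra! hcon
      have hYY := hgen (lPerp Λ {ModuleCat.of Λ Y}) (isTorsionClass_lPerp _)
        (fun Z hZ => ⟨hJ.1 Z hZ, by rintro _ rfl f; exact hYJ Z hZ f⟩)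
        ⟨hMfg, by rintro _ rfl f; exact hcon f⟩ hY
      have : Nontrivial Y := hg.nontrivial
      exact notMem_lPerp_self (s := ModuleCat.of Λ Y) hYY
    obtain ⟨f, hf⟩ := hne
    have hgf : g ∘ₗ f ≠ 0 := fun h => hf (hkerT (ModuleCat.of Λ M) hMT f (LinearMap.congr_fun h))
    have hinj : Function.Injective (g ∘ₗ f) :=
      IsNoetherian.injective_of_surjective_endomorphism _
        (hsurj (ModuleCat.of Λ M) hMT (g ∘ₗ f) hgf)
    let e := LinearEquiv.ofBijective (g ∘ₗ f)
      ⟨hinj, hsurj (ModuleCat.of Λ M) hMT (g ∘ₗ f) hgf⟩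
    have hp : ∀ y, g ((LinearMap.id - f ∘ₗ e.symm.toLinearMap ∘ₗ g : Y →ₗ[Λ] Y) y) = 0 := by
      intro y
      have : g (f (e.symm (g y))) = g y := e.apply_symm_apply (g y)
      simp [this]
    have hp0 := hkerT (ModuleCat.of Λ Y) hY _ hp
    rw [eq_bot_iff]
    intro y hy
    have hy0 := LinearMap.congr_fun hp0 y
    rw [Submodule.mem_bot]
    simpa [LinearMap.mem_ker.mp hy] using hy0
  have hMα : ModuleCat.of Λ M ∈ alphaOf Λ T := by
    refine ⟨hMT, fun Y (g : Y →ₗ[Λ] M) hY => ?_⟩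
    by_cases hg0 : g = 0
    · subst hg0
      exact hT.2.1.of_equiv (X := Y) (Submodule.topEquiv.symm.trans
        (LinearEquiv.ofEq _ _ LinearMap.ker_zero.symm)) hY
    have hg := hsurj Y hY g hg0
    have hYfg : Module.Finite Λ Y := hT.1 Y hY
    obtain ⟨u, huT, huF⟩ := hT.exists_torsion_part (LinearMap.ker g)
    set U : Submodule Λ Y := u.map (LinearMap.ker g).subtype with hU
    have hUmem : ∀ x : LinearMap.ker g, (x : Y) ∈ U ↔ x ∈ u := fun x => by simp [hU]
    have hUle : U ≤ LinearMap.ker g := Submodule.map_subtype_le _ _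
    have hQT : ModuleCat.of Λ (Y ⧸ U) ∈ T :=
      hT.2.2.2.1.of_surjective (X := Y) U.mkQ U.mkQ_surjective hY
    have hbot : LinearMap.ker (U.liftQ g hUle) = ⊥ := by
      refine hsplit (Y ⧸ U) hQT (U.liftQ g hUle) ?_ ⟨?_, fun Z hZ f => ?_⟩
      · intro m
        obtain ⟨y, rfl⟩ := hg m
        exact ⟨U.mkQ y, rfl⟩
      · exact inferInstanceAs (Module.Finite Λ (LinearMap.ker (U.liftQ g hUle)))
      · let φ : (LinearMap.ker g ⧸ u) →ₗ[Λ] LinearMap.ker (U.liftQ g hUle) :=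
          u.liftQ ((U.mkQ ∘ₗ (LinearMap.ker g).subtype).codRestrict _ fun x => x.2)
            (fun x hx => Subtype.ext ((Submodule.Quotient.mk_eq_zero U).mpr ((hUmem x).mpr hx)))
        have hφ : Function.Bijective φ := by
          constructor
          · rw [← LinearMap.ker_eq_bot, LinearMap.ker_eq_bot']
            intro q hq
            obtain ⟨x, rfl⟩ := u.mkQ_surjective q
            have hx : U.mkQ (x : Y) = 0 := congrArg Subtype.val hq
            exact (Submodule.Quotient.mk_eq_zero u).mpr
              ((hUmem x).mp ((Submodule.Quotient.mk_eq_zero U).mp hx))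
          · rintro ⟨q, hq⟩
            obtain ⟨y, rfl⟩ := U.mkQ_surjective q
            exact ⟨u.mkQ ⟨y, hq⟩, rfl⟩
        let e := LinearEquiv.ofBijective φ hφ
        have h0 := huF.2 Z hZ (e.symm.toLinearMap ∘ₗ f)
        ext z : 1
        exact (LinearEquiv.map_eq_zero_iff e.symm).mp (LinearMap.congr_fun h0 z)
    have hUeq : U = LinearMap.ker g := by
      refine le_antisymm hUle fun y hy => ?_
      have hy' : U.mkQ y ∈ LinearMap.ker (U.liftQ g hUle) := hy
      rw [hbot] at hy'
      exact (Submodule.Quotient.mk_eq_zero U).mp hy'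
    exact hT.2.1.of_equiv ((Submodule.equivMapOfInjective _
      (Submodule.injective_subtype _) u).trans (LinearEquiv.ofEq _ _ hUeq)) huT
  exact haM.trans (torsClosure_singleton_subset hT.isWide_alphaOf.isTorsionClass_torsClosure
    (subset_torsClosure _ hMα))

/-- A torsion class with a canonical join representation is generated by `α(T)`. -/
theorem IsCJR.torsClosure_alphaOf [IsArtinianRing Λ] {T : Set (ModuleCat.{0} Λ)}
    {A : Set (Set (ModuleCat.{0} Λ))} (hT : IsTorsionClass Λ T) (hA : IsCJR Λ T A) :
    torsClosure Λ (alphaOf Λ T) = T := by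
  refine subset_antisymm (torsClosure_subset hT fun X hX => hX.1) ?_
  conv_lhs => rw [← hA.1.2]
  exact torsJoin_subset hT.isWide_alphaOf.isTorsionClass_torsClosure
    fun a ha => hA.subset_torsClosure_alphaOf hT ha

end Auxiliary

/-- (Enomoto) For wide subcategories `W₁, W₂` of `mod Λ`: `T(W₁) ⊆ T(W₂)` with
`κ̄(T(W₁)) ⊇ κ̄(T(W₂))` and `T(W₁) ≠ T(W₂)` iff `W₁ ⊊ W₂`; consequently `W ↦ T(W)` is a poset
isomorphism from wide subcategories ordered by inclusion onto the torsion classes admitting a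
canonical join representation, with the kappa order. -/
theorem wide_poset_iso_kappa_order
    (K Λ : Type) [Field K] [Ring Λ] [Algebra K Λ] [FiniteDimensional K Λ] :
    (∀ W₁ W₂, IsWide Λ W₁ → IsWide Λ W₂ →
        ((torsClosure Λ W₁ ⊆ torsClosure Λ W₂ ∧
          (∀ K₁ K₂, IsKappaBar Λ (torsClosure Λ W₁) K₁ →
            IsKappaBar Λ (torsClosure Λ W₂) K₂ → K₂ ⊆ K₁) ∧
          torsClosure Λ W₁ ≠ torsClosure Λ W₂) ↔ W₁ ⊂ W₂)) ∧
    (∀ W, IsWide Λ W → ∃ A, IsCJR Λ (torsClosure Λ W) A) ∧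
    (∀ T, IsTorsionClass Λ T → (∃ A, IsCJR Λ T A) →
        ∃ W, IsWide Λ W ∧ torsClosure Λ W = T) ∧
    (∀ W₁ W₂, IsWide Λ W₁ → IsWide Λ W₂ →
        (W₁ ⊆ W₂ ↔ KappaLE Λ (torsClosure Λ W₁) (torsClosure Λ W₂))) := by
  have : IsArtinianRing Λ := IsArtinianRing.of_finite K Λ
  refine ⟨fun W₁ W₂ h₁ h₂ => ?_, fun W hW => ⟨_, hW.isCJR_simTors⟩,
    fun T hT ⟨A, hA⟩ => ⟨alphaOf Λ T, hT.isWide_alphaOf, hA.torsClosure_alphaOf hT⟩,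
    fun W₁ W₂ h₁ h₂ => h₁.subset_iff_kappaLE h₂⟩
  rw [Set.ssubset_iff_subset_ne, h₁.subset_iff_kappaLE h₂, KappaLE, and_assoc]
  exact and_congr_right fun _ => and_congr_right fun _ =>
    not_congr ⟨h₁.torsClosure_injective h₂, fun h => congrArg _ h⟩

end BrickPaper
end
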